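/- arXiv:1406.0017 — 10 statements merged into one kernel-verified Lean document; each statement's English description precedes it below -/
import Mathlib

section
/- For every finite bipartite graph G = (A,B,E) with at least one edge, |E| ≤ κ(G)·Cov(G); equivalently, |E|/κ(G) is a lower bound on the minimum weight of a biclique covering of G. -/
open Finset

section GraphDefs

variable {α β : Type*}

/-- `(p.1, p.2)` is a biclique of the bipartite graph `(A, B, E)`. -/
def IsBiclique (A : Finset α) (B : Finset β) (E : Finset (α × β))
    (p : Finset α × Finset β) : Prop :=
  p.1 ⊆ A ∧ p.2 ⊆ B ∧ p.1 ×ˢ p.2 ⊆ E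

/-- `C` is a biclique covering of the bipartite graph `(A, B, E)`. -/
def IsBicliqueCover (A : Finset α) (B : Finset β) (E : Finset (α × β))
    (C : Finset (Finset α × Finset β)) : Prop :=
  (∀ p ∈ C, IsBiclique A B E p) ∧ ∀ e ∈ E, ∃ p ∈ C, e.1 ∈ p.1 ∧ e.2 ∈ p.2

/-- The minimum weight of a biclique covering of the bipartite graph `(A, B, E)`. -/
noncomputable def Cov (A : Finset α) (B : Finset β) (E : Finset (α × β)) : ℕ :=
  sInf {w | ∃ C : Finset (Finset α × Finset β),
    IsBicliqueCover A B E C ∧ w = ∑ p ∈ C, (p.1.card + p.2.card)}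

/-- Vertices available to a rectifier network over classes `α` and `β`:
sources come from `α`, sinks from `β`, and inner nodes are indexed by `ℕ`. -/
abbrev RVert (α β : Type*) := α ⊕ β ⊕ ℕ

/-- A rectifier network realizing the bipartite graph `(A, B, E)`:
a finite DAG whose set of source vertices is (a copy of) `A`, whose set of sink
vertices is (a copy of) `B`, and in which `b` is reachable from `a` iff `(a, b) ∈ E`. -/
structure RectNet (A : Finset α) (B : Finset β) (E : Finset (α × β)) where
  V : Finset (RVert α β)
  Ed : Finset (RVert α β × RVert α β)
  mem_fst : ∀ e ∈ Ed, e.1 ∈ V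
  mem_snd : ∀ e ∈ Ed, e.2 ∈ V
  acyclic : ∀ v, ¬ Relation.TransGen (fun x y => (x, y) ∈ Ed) v v
  memA : ∀ a ∈ A, (Sum.inl a : RVert α β) ∈ V
  memB : ∀ b ∈ B, (Sum.inr (Sum.inl b) : RVert α β) ∈ V
  sources : ∀ v ∈ V, (∀ u, (u, v) ∉ Ed) ↔ ∃ a ∈ A, v = Sum.inl a
  sinks : ∀ v ∈ V, (∀ u, (v, u) ∉ Ed) ↔ ∃ b ∈ B, v = Sum.inr (Sum.inl b)
  realizes : ∀ a ∈ A, ∀ b ∈ B,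
    ((a, b) ∈ E ↔ Relation.ReflTransGen (fun x y => (x, y) ∈ Ed)
      (Sum.inl a) (Sum.inr (Sum.inl b)))

/-- The size of a rectifier network: its number of edges. -/
def RectNet.size {A : Finset α} {B : Finset β} {E : Finset (α × β)}
    (R : RectNet A B E) : ℕ := R.Ed.card

/-- The network has depth at most `k`: there is no directed path with `k + 1` edges. -/
def RectNet.DepthLE {A : Finset α} {B : Finset β} {E : Finset (α × β)}
    (R : RectNet A B E) (k : ℕ) : Prop :=
  ∀ f : ℕ → RVert α β, ∃ i ≤ k, (f i, f (i + 1)) ∉ R.Ed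

/-- The minimum size of a rectifier network realizing `(A, B, E)`. -/
noncomputable def Rect (A : Finset α) (B : Finset β) (E : Finset (α × β)) : ℕ :=
  sInf {n | ∃ R : RectNet A B E, R.size = n}

/-- The minimum size of a rectifier network of depth at most `k` realizing `(A, B, E)`. -/
noncomputable def RectDepth (k : ℕ) (A : Finset α) (B : Finset β) (E : Finset (α × β)) : ℕ :=
  sInf {n | ∃ R : RectNet A B E, R.DepthLE k ∧ R.size = n}

/-- `κ(G)`: the maximum of `|A'|·|B'| / (|A'| + |B'|)` over nonempty bicliques of `(A, B, E)`. -/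
noncomputable def kappa (A : Finset α) (B : Finset β) (E : Finset (α × β)) : ℝ :=
  sSup {h | ∃ p : Finset α × Finset β, IsBiclique A B E p ∧ p.1.Nonempty ∧ p.2.Nonempty ∧
    h = ((p.1.card : ℝ) * (p.2.card : ℝ)) / ((p.1.card : ℝ) + (p.2.card : ℝ))}

end GraphDefs

theorem bddAbove_biclique_ratios {α β : Type*} (A : Finset α) (B : Finset β)
    (E : Finset (α × β)) :
    BddAbove {h : ℝ | ∃ p : Finset α × Finset β,
      IsBiclique A B E p ∧ p.1.Nonempty ∧ p.2.Nonempty ∧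
      h = ((p.1.card : ℝ) * (p.2.card : ℝ)) / ((p.1.card : ℝ) + (p.2.card : ℝ))} := by
  refine ⟨A.card, ?_⟩
  rintro h ⟨p, hp, h1, h2, rfl⟩
  have ha : (0 : ℝ) < p.1.card := by exact_mod_cast h1.card_pos
  have hb : (0 : ℝ) < p.2.card := by exact_mod_cast h2.card_pos
  have hA : (p.1.card : ℝ) ≤ A.card := by exact_mod_cast card_le_card hp.1
  rw [div_le_iff₀ (by positivity)]
  nlinarith

theorem kappa_nonneg {α β : Type*} (A : Finset α) (B : Finset β) (E : Finset (α × β)) :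
    0 ≤ kappa A B E := by
  refine Real.sSup_nonneg ?_
  rintro h ⟨p, -, -, -, rfl⟩
  positivity

theorem IsBiclique.card_mul_card_le {α β : Type*} {A : Finset α} {B : Finset β}
    {E : Finset (α × β)} {p : Finset α × Finset β} (hp : IsBiclique A B E p) :
    (p.1.card : ℝ) * p.2.card ≤ kappa A B E * (p.1.card + p.2.card) := by
  have hk := kappa_nonneg A B E
  rcases p.1.eq_empty_or_nonempty with h1 | h1
  · simp only [h1, card_empty, Nat.cast_zero, zero_mul]
    positivity
  rcases p.2.eq_empty_or_nonempty with h2 | h2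
  · simp only [h2, card_empty, Nat.cast_zero, mul_zero]
    positivity
  have ha : (0 : ℝ) < p.1.card := by exact_mod_cast h1.card_pos
  rw [← div_le_iff₀ (by positivity)]
  exact le_csSup (bddAbove_biclique_ratios A B E) ⟨p, hp, h1, h2, rfl⟩

theorem IsBicliqueCover.card_le {α β : Type*} {A : Finset α} {B : Finset β}
    {E : Finset (α × β)} {C : Finset (Finset α × Finset β)} (hC : IsBicliqueCover A B E C) :
    (E.card : ℝ) ≤ kappa A B E * (∑ p ∈ C, (p.1.card + p.2.card) : ℕ) := by
  classical
  have hsub : E ⊆ C.biUnion fun p => p.1 ×ˢ p.2 := by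
    intro e he
    obtain ⟨p, hp, h⟩ := hC.2 e he
    exact mem_biUnion.2 ⟨p, hp, mem_product.2 h⟩
  have hcard : E.card ≤ ∑ p ∈ C, p.1.card * p.2.card := by
    simpa only [card_product] using (card_le_card hsub).trans card_biUnion_le
  calc (E.card : ℝ) ≤ ∑ p ∈ C, (p.1.card : ℝ) * p.2.card := by exact_mod_cast hcard
    _ ≤ ∑ p ∈ C, kappa A B E * (p.1.card + p.2.card) :=
      sum_le_sum fun p hp => (hC.1 p hp).card_mul_card_le
    _ = _ := by push_cast; rw [mul_sum]

theorem exists_isBicliqueCover {α β : Type*} {A : Finset α} {B : Finset β}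
    {E : Finset (α × β)} (hE : E ⊆ A ×ˢ B) : ∃ C, IsBicliqueCover A B E C := by
  classical
  refine ⟨E.image fun e => ({e.1}, {e.2}), ?_, fun e he =>
    ⟨_, mem_image_of_mem _ he, mem_singleton_self _, mem_singleton_self _⟩⟩
  intro p hp
  obtain ⟨e, he, rfl⟩ := mem_image.1 hp
  have h := mem_product.1 (hE he)
  exact ⟨singleton_subset_iff.2 h.1, singleton_subset_iff.2 h.2, by simpa using he⟩

/-- For every finite bipartite graph with at least one edge,
`|E| ≤ κ(G) · Cov(G)`. -/
theorem card_le_kappa_mul_cov {α β : Type*} (A : Finset α) (B : Finset β)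
    (E : Finset (α × β)) (hE : E ⊆ A ×ˢ B) (hne : E.Nonempty) :
    (E.card : ℝ) ≤ kappa A B E * (Cov A B E : ℝ) := by
  obtain ⟨C₀, hC₀⟩ := exists_isBicliqueCover hE
  obtain ⟨C, hC, hw⟩ := Nat.sInf_mem (s := {w | ∃ C : Finset (Finset α × Finset β),
    IsBicliqueCover A B E C ∧ w = ∑ p ∈ C, (p.1.card + p.2.card)}) ⟨_, C₀, hC₀, rfl⟩
  rw [Cov, hw]
  exact hC.card_le
end

section
/- For every positive even integer d, κ(G_⊥^d) = 2^{d/2 − 1}; that is, the maximum over all nonempty bicliques (A',B') of G_⊥^d of |A'|·|B'|/(|A'|+|B'|) equals 2^{d/2 − 1}. -/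
open Finset

/-- The edge set of the orthogonality graph `G_⊥^d`: both vertex classes are `{0,1}^d`
(modelled as `Fin d → ZMod 2`) and `(u, v)` is an edge iff `∑ i, u i * v i = 0` in `𝔽₂`. -/
def orthEdges (d : ℕ) : Finset ((Fin d → ZMod 2) × (Fin d → ZMod 2)) :=
  (Finset.univ ×ˢ Finset.univ).filter (fun p => ∑ i, p.1 i * p.2 i = 0)

/-- Two mutually orthogonal sets of vectors over a finite field `K` satisfy
`#A * #B ≤ #K ^ #ι`. -/
theorem card_mul_card_le_of_dotProduct_eq_zero {K ι : Type*} [Field K] [Fintype K] [Fintype ι]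
    (A B : Finset (ι → K)) (h : ∀ u ∈ A, ∀ v ∈ B, u ⬝ᵥ v = 0) :
    #A * #B ≤ Fintype.card K ^ Fintype.card ι := by
  classical
  let Φ := (Submodule.span K (A : Set (ι → K))).map (dotProductEquiv K ι).toLinearMap
  have hB : Submodule.span K (B : Set (ι → K)) ≤ Φ.dualCoannihilator := by
    rw [Submodule.span_le]
    intro v hv
    rw [SetLike.mem_coe, Submodule.mem_dualCoannihilator]
    rintro _ ⟨u, hu, rfl⟩
    change u ⬝ᵥ v = 0
    induction hu using Submodule.span_induction with
    | mem u hu => exact h u hu v hv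
    | zero => exact zero_dotProduct v
    | add x y _ _ hx hy => rw [add_dotProduct, hx, hy, add_zero]
    | smul c x _ hx => rw [smul_dotProduct, hx, smul_zero]
  have hrank : Module.finrank K (Submodule.span K (A : Set (ι → K))) +
      Module.finrank K (Submodule.span K (B : Set (ι → K))) ≤ Fintype.card ι := by
    have hΦ := Subspace.finrank_add_finrank_dualCoannihilator_eq Φ
    rw [Module.finrank_fintype_fun_eq_card, LinearEquiv.finrank_map_eq] at hΦ
    have := Submodule.finrank_mono hB
    lia
  have hcard (S : Finset (ι → K)) :
      #S ≤ Fintype.card K ^ Module.finrank K (Submodule.span K (S : Set (ι → K))) := by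
    rw [← Nat.card_eq_fintype_card, ← Module.natCard_eq_pow_finrank, ← Set.ncard_coe_finset]
    exact Set.ncard_le_ncard Submodule.subset_span (Set.toFinite _)
  calc #A * #B ≤ _ := Nat.mul_le_mul (hcard A) (hcard B)
    _ ≤ _ := by
      rw [← pow_add]
      exact Nat.pow_le_pow_right Fintype.card_pos hrank

theorem card_piFinset_ite_singleton {ι α : Type*} [Fintype ι] [DecidableEq ι] [Fintype α]
    (P : ι → Prop) [DecidablePred P] (a : α) :
    #(Fintype.piFinset fun i => if P i then (univ : Finset α) else {a}) =
      Fintype.card α ^ #{i | P i} := by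
  simp [Fintype.card_piFinset, apply_ite card, prod_ite]

theorem mul_div_add_le_of_mul_le {a b n : ℝ} (ha : 0 < a) (hb : 0 < b) (hn : 0 ≤ n)
    (h : a * b ≤ (2 * n) ^ 2) : a * b / (a + b) ≤ n := by
  rw [div_le_iff₀ (by positivity)]
  apply le_of_sq_le_sq _ (by positivity)
  nlinarith [mul_le_mul_of_nonneg_left h (by positivity : 0 ≤ a * b),
    mul_nonneg (sq_nonneg n) (sq_nonneg (a - b))]

/-- for every positive even integer `d`, `κ(G_⊥^d) = 2^(d/2 - 1)`. -/
theorem kappa_orth (d : ℕ) (hd : 0 < d) (hde : Even d) :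
    kappa (Finset.univ : Finset (Fin d → ZMod 2)) (Finset.univ : Finset (Fin d → ZMod 2))
      (orthEdges d) = 2 ^ (d / 2 - 1) := by
  obtain ⟨m, rfl⟩ := hde.two_dvd
  obtain ⟨k, rfl⟩ : ∃ k, m = k + 1 := ⟨m - 1, by lia⟩
  rw [show 2 * (k + 1) / 2 - 1 = k by lia]
  refine IsGreatest.csSup_eq ⟨?_, ?_⟩
  · let P : Fin (2 * (k + 1)) → Prop := fun i => i.val < k + 1
    have hP : #{i | P i} = k + 1 := by
      rw [Fin.card_filter_val_lt]
      lia
    have hP' : #{i | ¬ P i} = k + 1 := by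
      have := card_filter_add_card_filter_not (s := (univ : Finset (Fin (2 * (k + 1))))) P
      rw [card_univ, Fintype.card_fin] at this
      lia
    let A := Fintype.piFinset fun i => if P i then (univ : Finset (ZMod 2)) else {0}
    let B := Fintype.piFinset fun i => if ¬ P i then (univ : Finset (ZMod 2)) else {0}
    have hA : #A = 2 ^ (k + 1) := by rw [card_piFinset_ite_singleton, hP, ZMod.card]
    have hB : #B = 2 ^ (k + 1) := by rw [card_piFinset_ite_singleton, hP', ZMod.card]
    refine ⟨(A, B), ⟨subset_univ _, subset_univ _, ?_⟩, card_pos.mp (by simp [hA]),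
      card_pos.mp (by simp [hB]), ?_⟩
    · rintro ⟨u, v⟩ huv
      obtain ⟨hu, hv⟩ := mem_product.mp huv
      simp only [A, B, Fintype.mem_piFinset] at hu hv
      refine mem_filter.mpr ⟨by simp, sum_eq_zero fun i _ => ?_⟩
      by_cases hi : P i
      · have := hv i
        simp_all
      · have := hu i
        simp_all
    · simp only [hA, hB]
      push_cast
      field_simp
      ring
  · rintro _ ⟨⟨A, B⟩, ⟨-, -, hE⟩, hA, hB, rfl⟩
    have hcard := card_mul_card_le_of_dotProduct_eq_zero A B fun u hu v hv =>
      (mem_filter.mp (hE (mk_mem_product hu hv))).2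
    rw [ZMod.card, Fintype.card_fin] at hcard
    refine mul_div_add_le_of_mul_le (by exact_mod_cast hA.card_pos)
      (by exact_mod_cast hB.card_pos) (by positivity) ?_
    rw [← pow_succ', ← pow_mul, mul_comm (k + 1)]
    exact_mod_cast hcard
end

section
/- For every positive even integer d, the minimum weight of a biclique covering of the orthogonality graph satisfies Cov(G_⊥^d) ≥ 2^{3d/2}. -/
open Finset

/-- Every vector is orthogonal to at least half of the space `𝔽₂^d`. -/
lemma two_pow_le_two_mul_card_orth (d : ℕ) (u : Fin d → ZMod 2) :
    2 ^ d ≤ 2 * (univ.filter fun v : Fin d → ZMod 2 => ∑ i, u i * v i = 0).card := by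
  let f := dotProductEquiv (ZMod 2) (Fin d) u
  have hdim := LinearMap.finrank_range_add_finrank_ker f
  have hrange : Module.finrank (ZMod 2) (LinearMap.range f) ≤ 1 := by
    simpa using Submodule.finrank_le (LinearMap.range f)
  have hker := Module.natCard_eq_pow_finrank (K := ZMod 2) (V := LinearMap.ker f)
  have hcard : (univ.filter fun v : Fin d → ZMod 2 => ∑ i, u i * v i = 0).card =
      Nat.card (LinearMap.ker f) := by
    rw [← Nat.card_eq_finsetCard]
    exact Nat.card_congr (Equiv.subtypeEquivRight fun v => mem_filter_univ v)
  rw [hcard, hker, Nat.card_zmod, ← pow_succ']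
  apply Nat.pow_le_pow_right two_pos
  simp only [Module.finrank_fintype_fun_eq_card, Fintype.card_fin] at hdim
  omega

/-- Mutually orthogonal sets of vectors in `𝔽₂^d` have sizes with product at most `2^d`. -/
lemma card_mul_card_le_of_orthogonal (d : ℕ) (s t : Finset (Fin d → ZMod 2))
    (h : ∀ u ∈ s, ∀ v ∈ t, ∑ i, u i * v i = 0) : s.card * t.card ≤ 2 ^ d := by
  let W := Submodule.span (ZMod 2) (s : Set (Fin d → ZMod 2))
  let φ := dotProductEquiv (ZMod 2) (Fin d)
  let W' := W.dualAnnihilator.comap φ.toLinearMap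
  have hs : s.card ≤ Nat.card W := by
    rw [← Nat.card_eq_finsetCard s]
    exact Nat.card_mono (Set.toFinite _) Submodule.subset_span
  have hsub : (t : Set (Fin d → ZMod 2)) ⊆ W' := by
    intro v hv
    refine (Submodule.mem_dualAnnihilator _).2 fun w hw => ?_
    have hle : W ≤ LinearMap.ker (φ v) := by
      refine Submodule.span_le.2 fun u hu => ?_
      change ∑ i, v i * u i = 0
      simpa only [mul_comm] using h u hu v hv
    exact hle hw
  have ht : t.card ≤ Nat.card W' := by
    rw [← Nat.card_eq_finsetCard t]
    exact Nat.card_mono (Set.toFinite _) hsub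
  have hW' : Module.finrank (ZMod 2) W' = Module.finrank (ZMod 2) W.dualAnnihilator :=
    (φ.ofSubmodule' W.dualAnnihilator).finrank_eq
  have hdim := Subspace.finrank_add_finrank_dualAnnihilator_eq W
  rw [Module.finrank_fintype_fun_eq_card, Fintype.card_fin] at hdim
  calc s.card * t.card ≤ Nat.card W * Nat.card W' := Nat.mul_le_mul hs ht
    _ = 2 ^ d := by
      rw [Module.natCard_eq_pow_finrank (K := ZMod 2) (V := W),
        Module.natCard_eq_pow_finrank (K := ZMod 2) (V := W'), hW', ← pow_add, hdim, Nat.card_zmod]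

lemma two_pow_le_two_mul_card_orthEdges (d : ℕ) :
    2 ^ d * 2 ^ d ≤ 2 * (orthEdges d).card := by
  have hcard : (orthEdges d).card =
      ∑ u : Fin d → ZMod 2, (univ.filter fun v : Fin d → ZMod 2 => ∑ i, u i * v i = 0).card := by
    simp only [orthEdges, card_filter, sum_product]
  rw [hcard, mul_sum]
  calc 2 ^ d * 2 ^ d = ∑ _u : Fin d → ZMod 2, 2 ^ d := by simp
    _ ≤ _ := sum_le_sum fun u _ => two_pow_le_two_mul_card_orth d u

/-- A biclique covering always exists, so `Cov` is attained by one. -/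
lemma exists_isBicliqueCover_weight_eq_cov {α β : Type*} (A : Finset α) (B : Finset β)
    (E : Finset (α × β)) (hE : E ⊆ A ×ˢ B) :
    ∃ C : Finset (Finset α × Finset β),
      IsBicliqueCover A B E C ∧ Cov A B E = ∑ p ∈ C, (p.1.card + p.2.card) := by
  classical
  refine Nat.sInf_mem (s := {w | ∃ C : Finset (Finset α × Finset β),
    IsBicliqueCover A B E C ∧ w = ∑ p ∈ C, (p.1.card + p.2.card)})
    ⟨_, E.image fun e => ({e.1}, {e.2}), ⟨fun p hp => ?_, fun e he => ?_⟩, rfl⟩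
  · obtain ⟨e, he, rfl⟩ := mem_image.1 hp
    have hmem := mem_product.1 (hE he)
    refine ⟨?_, ?_, ?_⟩ <;> simp [hmem, he]
  · exact ⟨_, mem_image_of_mem _ he, by simp⟩

lemma card_edges_le_of_isBicliqueCover {α β : Type*} {A : Finset α} {B : Finset β}
    {E : Finset (α × β)} {C : Finset (Finset α × Finset β)} (hC : IsBicliqueCover A B E C) :
    E.card ≤ ∑ p ∈ C, p.1.card * p.2.card := by
  classical
  have hsub : E ⊆ C.biUnion fun p => p.1 ×ˢ p.2 := by
    intro e he
    obtain ⟨p, hp, h⟩ := hC.2 e he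
    exact mem_biUnion.2 ⟨p, hp, mem_product.2 h⟩
  calc E.card ≤ _ := card_le_card hsub
    _ ≤ ∑ p ∈ C, (p.1 ×ˢ p.2).card := card_biUnion_le
    _ = _ := by simp only [card_product]

lemma two_mul_mul_le_mul_add {N a b : ℕ} (h : a * b ≤ N * N) : 2 * (a * b) ≤ N * (a + b) := by
  by_contra! hlt
  nlinarith [Nat.mul_le_mul h (le_refl (4 * (a * b))), Nat.mul_self_lt_mul_self hlt,
    Nat.mul_le_mul_left (N * N) (four_mul_le_sq_add a b)]

/-- for every positive even integer `d`, `Cov(G_⊥^d) ≥ 2^(3d/2)`. -/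
theorem cov_orth_ge (d : ℕ) (hd : 0 < d) (hde : Even d) :
    2 ^ (3 * (d / 2)) ≤
      Cov (Finset.univ : Finset (Fin d → ZMod 2)) (Finset.univ : Finset (Fin d → ZMod 2))
        (orthEdges d) := by
  obtain ⟨C, hC, hw⟩ := exists_isBicliqueCover_weight_eq_cov
    (univ : Finset (Fin d → ZMod 2)) (univ : Finset (Fin d → ZMod 2)) (orthEdges d)
    (filter_subset _ _)
  rw [hw]
  set N := 2 ^ (d / 2) with hN
  have hNpos : 0 < N := by positivity
  have hNN : 2 ^ d = N * N := by
    rw [hN, ← pow_add, ← two_mul, Nat.two_mul_div_two_of_even hde]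
  have hterm : ∀ p ∈ C, 2 * (p.1.card * p.2.card) ≤ N * (p.1.card + p.2.card) := by
    intro p hp
    refine two_mul_mul_le_mul_add (hNN ▸ card_mul_card_le_of_orthogonal d p.1 p.2 ?_)
    intro u hu v hv
    exact (mem_filter.1 ((hC.1 p hp).2.2 (mk_mem_product hu hv))).2
  have hsum := sum_le_sum hterm
  rw [← mul_sum, ← mul_sum] at hsum
  have hedges := two_pow_le_two_mul_card_orthEdges d
  have hcover := card_edges_le_of_isBicliqueCover hC
  rw [hNN] at hedges
  rw [mul_comm 3, pow_mul, ← hN]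
  refine Nat.le_of_mul_le_mul_left ?_ hNpos
  calc N * N ^ 3 = N * N * (N * N) := by ring
    _ ≤ _ := by omega
end

section
/- There is a constant C > 0 such that for every positive integer d and every permutation invariant bipartite graph G with both vertex classes equal to {0,1}^d, the minimum size of a rectifier network realizing G satisfies Rect(G) ≤ C·2^d·(d+1)^5. -/
open Finset

/-- A bipartite graph on vertex classes `{0,1}^d` is permutation invariant if its edge set
is closed under simultaneously permuting the coordinates of both endpoints. -/
def PermInvariant {d : ℕ} (E : Finset ((Fin d → ZMod 2) × (Fin d → ZMod 2))) : Prop :=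
  ∀ p ∈ E, ∀ π : Equiv.Perm (Fin d), (p.1 ∘ π, p.2 ∘ π) ∈ E

section Aux

variable {α β : Type*}

theorem exists_perm_of_map_univ_eq {ι γ : Type*} [Fintype ι] {f g : ι → γ}
    (h : univ.val.map f = univ.val.map g) : ∃ σ : Equiv.Perm ι, g ∘ σ = f := by
  classical
  have key : ∀ c, Nonempty ({i // f i = c} ≃ {i // g i = c}) := by
    intro c
    rw [← Fintype.card_eq, Fintype.card_subtype, Fintype.card_subtype]
    have hc := congrArg (Multiset.count c) h
    rw [Multiset.count_map, Multiset.count_map] at hc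
    simp only [eq_comm (a := c)] at hc
    exact hc
  exact ⟨Equiv.ofFiberEquiv fun c => (key c).some,
    funext fun i => Equiv.ofFiberEquiv_map _ i⟩

/-- In a rectifier network every vertex reaches some sink. -/
theorem RectNet.exists_reaches_sink {A : Finset α} {B : Finset β} {E : Finset (α × β)}
    (R : RectNet A B E) {v : RVert α β} (hv : v ∈ R.V) :
    ∃ b ∈ B, Relation.ReflTransGen (fun x y => (x, y) ∈ R.Ed) v (Sum.inr (Sum.inl b)) := by
  let r : RVert α β → RVert α β → Prop := Relation.TransGen fun x y => (y, x) ∈ R.Ed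
  have hr : IsStrictOrder _ r :=
    { irrefl := fun a h => R.acyclic a (Relation.transGen_swap.1 h)
      trans := fun _ _ _ => Relation.TransGen.trans }
  refine (R.V.wellFoundedOn (r := r)).induction (P := fun v =>
    ∃ b ∈ B, Relation.ReflTransGen (fun x y => (x, y) ∈ R.Ed) v (Sum.inr (Sum.inl b))) hv ?_
  intro x hx ih
  by_cases h : ∀ u, (x, u) ∉ R.Ed
  · obtain ⟨b, hb, rfl⟩ := (R.sinks x hx).1 h
    exact ⟨b, hb, .refl⟩
  · push Not at h
    obtain ⟨u, hu⟩ := h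
    obtain ⟨b, hb, hub⟩ := ih u (R.mem_snd _ hu) (.single hu)
    exact ⟨b, hb, .head hu hub⟩

/-- In a rectifier network every vertex is reached from some source. -/
theorem RectNet.exists_source_reaches {A : Finset α} {B : Finset β} {E : Finset (α × β)}
    (R : RectNet A B E) {v : RVert α β} (hv : v ∈ R.V) :
    ∃ a ∈ A, Relation.ReflTransGen (fun x y => (x, y) ∈ R.Ed) (Sum.inl a) v := by
  let r : RVert α β → RVert α β → Prop := Relation.TransGen fun x y => (x, y) ∈ R.Ed
  have hr : IsStrictOrder _ r :=
    { irrefl := R.acyclic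
      trans := fun _ _ _ => Relation.TransGen.trans }
  refine (R.V.wellFoundedOn (r := r)).induction (P := fun v =>
    ∃ a ∈ A, Relation.ReflTransGen (fun x y => (x, y) ∈ R.Ed) (Sum.inl a) v) hv ?_
  intro x hx ih
  by_cases h : ∀ u, (u, x) ∉ R.Ed
  · obtain ⟨a, ha, rfl⟩ := (R.sources x hx).1 h
    exact ⟨a, ha, .refl⟩
  · push Not at h
    obtain ⟨u, hu⟩ := h
    obtain ⟨a, ha, hau⟩ := ih u (R.mem_fst _ hu) (.single hu)
    exact ⟨a, ha, .tail hau hu⟩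

/-- Deleting the edges that lie on no source-sink path turns an acyclic edge set with the right
reachability relation into a rectifier network, provided the bipartite graph has no isolated
vertex; if it has one, there is no rectifier network at all and `Rect` is zero. -/
theorem rect_le_card_of_reachability {A : Finset α} {B : Finset β} {E : Finset (α × β)}
    (D : Finset (RVert α β × RVert α β)) (rank : RVert α β → ℕ)
    (hrank : ∀ e ∈ D, rank e.1 < rank e.2)
    (hin : ∀ u a, (u, Sum.inl a) ∉ D) (hout : ∀ b u, (Sum.inr (Sum.inl b), u) ∉ D)
    (hD : ∀ a ∈ A, ∀ b ∈ B, ((a, b) ∈ E ↔ Relation.ReflTransGen (fun x y => (x, y) ∈ D)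
      (Sum.inl a) (Sum.inr (Sum.inl b)))) :
    Rect A B E ≤ D.card := by
  classical
  rcases Set.eq_empty_or_nonempty {n | ∃ R : RectNet A B E, R.size = n} with h0 | ⟨_, R, -⟩
  · simp [Rect, h0]
  let P := Relation.ReflTransGen (fun x y => (x, y) ∈ D)
  have hA : ∀ a ∈ A, ∃ b ∈ B, P (Sum.inl a) (Sum.inr (Sum.inl b)) := fun a ha => by
    obtain ⟨b, hb, h⟩ := R.exists_reaches_sink (R.memA a ha)
    exact ⟨b, hb, (hD a ha b hb).1 ((R.realizes a ha b hb).2 h)⟩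
  have hB : ∀ b ∈ B, ∃ a ∈ A, P (Sum.inl a) (Sum.inr (Sum.inl b)) := fun b hb => by
    obtain ⟨a, ha, h⟩ := R.exists_source_reaches (R.memB b hb)
    exact ⟨a, ha, (hD a ha b hb).1 ((R.realizes a ha b hb).2 h)⟩
  clear R
  let Keep : RVert α β → Prop := fun v =>
    (∃ a ∈ A, P (Sum.inl a) v) ∧ ∃ b ∈ B, P v (Sum.inr (Sum.inl b))
  let D' := D.filter fun e => Keep e.1 ∧ Keep e.2
  let V := D'.image Prod.fst ∪ D'.image Prod.snd
  have hsub : D' ⊆ D := filter_subset _ _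
  have hmem : ∀ x y, (x, y) ∈ D → (∃ a ∈ A, P (Sum.inl a) x) →
      (∃ b ∈ B, P y (Sum.inr (Sum.inl b))) → (x, y) ∈ D' := by
    rintro x y hxy ⟨a, ha, hax⟩ ⟨b, hb, hyb⟩
    exact mem_filter.2 ⟨hxy, ⟨⟨a, ha, hax⟩, b, hb, .head hxy hyb⟩, ⟨a, ha, .tail hax hxy⟩, b, hb, hyb⟩
  have hfst : ∀ e ∈ D', e.1 ∈ V := fun e he => mem_union_left _ (mem_image_of_mem _ he)
  have hsnd : ∀ e ∈ D', e.2 ∈ V := fun e he => mem_union_right _ (mem_image_of_mem _ he)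
  have hKeep : ∀ v ∈ V, Keep v := by
    intro v hv
    rcases mem_union.1 hv with h | h <;> obtain ⟨e, he, rfl⟩ := mem_image.1 h
    · exact (mem_filter.1 he).2.1
    · exact (mem_filter.1 he).2.2
  have hlt : ∀ x y, Relation.TransGen (fun x y => (x, y) ∈ D') x y → rank x < rank y := by
    intro x y h
    induction h with
    | single h => exact hrank _ (hsub h)
    | tail _ h ih => exact ih.trans (hrank _ (hsub h))
  have hpath : ∀ x y, P x y → (∃ a ∈ A, P (Sum.inl a) x) → (∃ b ∈ B, P y (Sum.inr (Sum.inl b))) →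
      Relation.ReflTransGen (fun x y => (x, y) ∈ D') x y := by
    rintro x y h ⟨a, ha, hax⟩
    induction h with
    | refl => exact fun _ => .refl
    | tail h1 h2 ih =>
      rintro ⟨b, hb, hyb⟩
      exact .tail (ih ⟨b, hb, .head h2 hyb⟩) (hmem _ _ h2 ⟨a, ha, hax.trans h1⟩ ⟨b, hb, hyb⟩)
  have houtA : ∀ a ∈ A, ∃ y, (Sum.inl a, y) ∈ D' := by
    intro a ha
    obtain ⟨b, hb, h⟩ := hA a ha
    rcases h.cases_head with h | ⟨c, h1, h2⟩
    · cases h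
    · exact ⟨c, hmem _ _ h1 ⟨a, ha, .refl⟩ ⟨b, hb, h2⟩⟩
  have hinB : ∀ b ∈ B, ∃ x, (x, Sum.inr (Sum.inl b)) ∈ D' := by
    intro b hb
    obtain ⟨a, ha, h⟩ := hB b hb
    rcases h.cases_tail with h | ⟨c, h1, h2⟩
    · cases h
    · exact ⟨c, hmem _ _ h2 ⟨a, ha, h1⟩ ⟨b, hb, .refl⟩⟩
  refine le_trans (Nat.sInf_le (m := D'.card) ⟨⟨V, D', hfst, hsnd, fun v h => (hlt v v h).false,
    ?_, ?_, ?_, ?_, ?_⟩, rfl⟩) (card_le_card hsub)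
  · intro a ha
    obtain ⟨y, hy⟩ := houtA a ha
    exact hfst _ hy
  · intro b hb
    obtain ⟨x, hx⟩ := hinB b hb
    exact hsnd _ hx
  · intro v hv
    constructor
    · intro h
      obtain ⟨⟨a, ha, hav⟩, hb⟩ := hKeep v hv
      rcases hav.cases_tail with h' | ⟨c, h1, h2⟩
      · exact ⟨a, ha, h'⟩
      · exact (h c (hmem _ _ h2 ⟨a, ha, h1⟩ hb)).elim
    · rintro ⟨a, -, rfl⟩ u hu
      exact hin u a (hsub hu)
  · intro v hv
    constructor
    · intro h
      obtain ⟨ha, b, hb, hvb⟩ := hKeep v hv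
      rcases hvb.cases_head with h' | ⟨c, h1, h2⟩
      · exact ⟨b, hb, h'⟩
      · exact (h c (hmem _ _ h1 ha ⟨b, hb, h2⟩)).elim
    · rintro ⟨b, -, rfl⟩ u hu
      exact hout b u (hsub hu)
  · intro a ha b hb
    rw [hD a ha b hb]
    exact ⟨fun h => hpath _ _ h ⟨a, ha, .refl⟩ ⟨b, hb, .refl⟩,
      fun h => Relation.ReflTransGen.mono (fun _ _ h => hsub h) _ _ h⟩

variable {d : ℕ}

/-- The vector that agrees with `v` on the first `k` coordinates and with `u` on the others. -/
def hybrid (u v : Fin d → ZMod 2) (k : ℕ) : Fin d → ZMod 2 :=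
  fun j => if (j : ℕ) < k then v j else u j

/-- The multiset of pairs `(u j, v j)` over the first `k` coordinates `j`. -/
def prefixType (u v : Fin d → ZMod 2) (k : ℕ) : Multiset (ZMod 2 × ZMod 2) :=
  (univ.filter fun j : Fin d => (j : ℕ) < k).val.map fun j => (u j, v j)

theorem hybrid_zero (u v : Fin d → ZMod 2) : hybrid u v 0 = u := by
  ext1 j
  simp [hybrid]

theorem hybrid_full (u v : Fin d → ZMod 2) : hybrid u v d = v := by
  ext1 j
  simp [hybrid]

theorem hybrid_apply_self (u v : Fin d → ZMod 2) (i : Fin d) : hybrid u v i i = u i := by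
  simp [hybrid]

theorem hybrid_succ (u v : Fin d → ZMod 2) (i : Fin d) (b : ZMod 2) :
    hybrid u (Function.update v i b) (i + 1) = Function.update (hybrid u v i) i b := by
  ext1 j
  rcases eq_or_ne j i with rfl | h
  · simp [hybrid]
  · have : (j : ℕ) ≠ i := Fin.val_ne_of_ne h
    have hiff : (j : ℕ) < i + 1 ↔ (j : ℕ) < i := by omega
    simp [hybrid, h, hiff]

theorem prefixType_zero (u v : Fin d → ZMod 2) : prefixType u v 0 = 0 := by
  simp [prefixType]

theorem prefixType_full (u v : Fin d → ZMod 2) :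
    prefixType u v d = univ.val.map fun j => (u j, v j) := by
  simp [prefixType]

theorem prefixType_succ (u v : Fin d → ZMod 2) (i : Fin d) (b : ZMod 2) :
    prefixType u (Function.update v i b) (i + 1) = (u i, b) ::ₘ prefixType u v i := by
  have hs : (univ.filter fun j : Fin d => (j : ℕ) < i + 1) =
      cons i (univ.filter fun j : Fin d => (j : ℕ) < i) (by simp) := by
    ext j
    simp only [mem_filter, mem_univ, true_and, mem_cons, Fin.ext_iff]
    omega
  rw [prefixType, hs, cons_val, Multiset.map_cons, Function.update_self, prefixType]
  congr 1
  refine Multiset.map_congr rfl fun j hj => ?_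
  have hj' : (j : ℕ) < i := by simpa using hj
  rw [Function.update_of_ne (Fin.ne_of_lt hj')]

theorem card_prefixType (u v : Fin d → ZMod 2) {k : ℕ} (hk : k ≤ d) :
    (prefixType u v k).card = k := by
  rw [prefixType, Multiset.card_map]
  exact Fin.card_filter_val_lt.trans (min_eq_right hk)

/-- All multisets of pairs of bits in which each pair has multiplicity at most `d`. -/
def boundedTypes (d : ℕ) : Finset (Multiset (ZMod 2 × ZMod 2)) :=
  Iic (d • (univ : Finset (ZMod 2 × ZMod 2)).val)

theorem card_boundedTypes (hd : 0 < d) : (boundedTypes d).card = (d + 1) ^ 4 := by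
  have hc : ∀ i, Multiset.count i (d • (univ : Finset (ZMod 2 × ZMod 2)).val) = d := fun i => by
    rw [Multiset.count_nsmul, Multiset.count_univ, mul_one]
  rw [boundedTypes, Multiset.card_Iic, Multiset.toFinset_nsmul _ _ hd.ne', val_toFinset]
  simp [hc]

theorem prefixType_mem_boundedTypes (u v : Fin d → ZMod 2) {k : ℕ} (hk : k ≤ d) :
    prefixType u v k ∈ boundedTypes d := by
  refine mem_Iic.2 (Multiset.le_iff_count.2 fun a => ?_)
  rw [Multiset.count_nsmul, Multiset.count_univ, mul_one]
  exact (Multiset.count_le_card _ _).trans ((card_prefixType u v hk).le.trans hk)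

/-- A network scanning the coordinates one at a time. The inner node `(w, s)` records the current
hybrid vector `w` and the multiset `s` of pairs of bits seen so far. -/
noncomputable def scanEdges (E : Finset ((Fin d → ZMod 2) × (Fin d → ZMod 2)))
    (enc : (Fin d → ZMod 2) × Multiset (ZMod 2 × ZMod 2) → ℕ) :
    Finset (RVert (Fin d → ZMod 2) (Fin d → ZMod 2) × RVert (Fin d → ZMod 2) (Fin d → ZMod 2)) :=
  open Classical in
  (univ.image fun u => (Sum.inl u, Sum.inr (Sum.inr (enc (u, 0))))) ∪
  (((univ : Finset (Fin d × ZMod 2 × (Fin d → ZMod 2))) ×ˢ boundedTypes d).filter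
      fun x => x.2.card = x.1.1).image
    (fun x => (Sum.inr (Sum.inr (enc (x.1.2.2, x.2))),
      Sum.inr (Sum.inr (enc (Function.update x.1.2.2 x.1.1 x.1.2.1,
        (x.1.2.2 x.1.1, x.1.2.1) ::ₘ x.2))))) ∪
  (((univ : Finset (Fin d → ZMod 2)) ×ˢ boundedTypes d).filter
      fun x => ∃ u, (u, x.1) ∈ E ∧ x.2 = prefixType u x.1 d).image
    (fun x => (Sum.inr (Sum.inr (enc x)), Sum.inr (Sum.inl x.1)))

theorem mem_scanEdges {E : Finset ((Fin d → ZMod 2) × (Fin d → ZMod 2))}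
    {enc : (Fin d → ZMod 2) × Multiset (ZMod 2 × ZMod 2) → ℕ}
    {e : RVert (Fin d → ZMod 2) (Fin d → ZMod 2) × RVert (Fin d → ZMod 2) (Fin d → ZMod 2)} :
    e ∈ scanEdges E enc ↔
      (∃ u, e = (Sum.inl u, Sum.inr (Sum.inr (enc (u, 0))))) ∨
      (∃ i b w, ∃ s ∈ boundedTypes d, s.card = (i : Fin d) ∧
        e = (Sum.inr (Sum.inr (enc (w, s))),
          Sum.inr (Sum.inr (enc (Function.update w i b, (w i, b) ::ₘ s))))) ∨
      (∃ u w, (u, w) ∈ E ∧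
        e = (Sum.inr (Sum.inr (enc (w, prefixType u w d))), Sum.inr (Sum.inl w))) := by
  classical
  simp only [scanEdges, mem_union, mem_image, mem_filter, mem_product, mem_univ, true_and,
    or_assoc]
  refine or_congr ⟨fun ⟨u, h⟩ => ⟨u, h.symm⟩, fun ⟨u, h⟩ => ⟨u, h.symm⟩⟩ (or_congr ⟨?_, ?_⟩ ⟨?_, ?_⟩)
  · rintro ⟨⟨⟨i, b, w⟩, s⟩, ⟨hs, hi⟩, rfl⟩
    exact ⟨i, b, w, s, hs, hi, rfl⟩
  · rintro ⟨i, b, w, s, hs, hi, rfl⟩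
    exact ⟨⟨⟨i, b, w⟩, s⟩, ⟨hs, hi⟩, rfl⟩
  · rintro ⟨⟨w, s⟩, ⟨-, u, hu, hs⟩, rfl⟩
    obtain rfl : s = prefixType u w d := hs
    exact ⟨u, w, hu, rfl⟩
  · rintro ⟨u, w, hu, rfl⟩
    exact ⟨⟨w, _⟩, ⟨prefixType_mem_boundedTypes u w le_rfl, u, hu, rfl⟩, rfl⟩

theorem card_scanEdges_le (hd : 0 < d) (E : Finset ((Fin d → ZMod 2) × (Fin d → ZMod 2)))
    (enc : (Fin d → ZMod 2) × Multiset (ZMod 2 × ZMod 2) → ℕ) :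
    (scanEdges E enc).card ≤ 4 * 2 ^ d * (d + 1) ^ 5 := by
  classical
  have hV : Fintype.card (Fin d → ZMod 2) = 2 ^ d := by simp [ZMod.card]
  refine (card_union_le _ _).trans ((Nat.add_le_add ((card_union_le _ _).trans
    (Nat.add_le_add card_image_le (card_image_le.trans (card_filter_le _ _))))
    (card_image_le.trans (card_filter_le _ _))).trans ?_)
  rw [card_product, card_product, card_boundedTypes hd, card_univ, card_univ, Fintype.card_prod,
    Fintype.card_prod, hV, Fintype.card_fin, ZMod.card]
  have h1 : 1 ≤ (d + 1) ^ 5 := Nat.one_le_pow _ _ (by omega)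
  have h2 : (d + 1) ^ 4 ≤ (d + 1) ^ 5 := Nat.pow_le_pow_right (by omega) (by omega)
  have h3 : d * (d + 1) ^ 4 ≤ (d + 1) ^ 5 := by
    rw [pow_succ' _ 4]; exact Nat.mul_le_mul_right _ (by omega)
  calc 2 ^ d + d * (2 * 2 ^ d) * (d + 1) ^ 4 + 2 ^ d * (d + 1) ^ 4
      = 2 ^ d * (1 + 2 * (d * (d + 1) ^ 4) + (d + 1) ^ 4) := by ring
    _ ≤ 2 ^ d * (4 * (d + 1) ^ 5) := Nat.mul_le_mul_left _ (by omega)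
    _ = 4 * 2 ^ d * (d + 1) ^ 5 := by ring

theorem scanEdges_reaches {E : Finset ((Fin d → ZMod 2) × (Fin d → ZMod 2))}
    {enc : (Fin d → ZMod 2) × Multiset (ZMod 2 × ZMod 2) → ℕ} {u v : Fin d → ZMod 2}
    (huv : (u, v) ∈ E) :
    Relation.ReflTransGen (fun x y => (x, y) ∈ scanEdges E enc)
      (Sum.inl u) (Sum.inr (Sum.inl v)) := by
  have key : ∀ k ≤ d, Relation.ReflTransGen (fun x y => (x, y) ∈ scanEdges E enc)
      (Sum.inl u) (Sum.inr (Sum.inr (enc (hybrid u v k, prefixType u v k)))) := by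
    intro k
    induction k with
    | zero =>
      intro _
      rw [hybrid_zero, prefixType_zero]
      exact .single (mem_scanEdges.2 (.inl ⟨u, rfl⟩))
    | succ k ih =>
      intro hk
      refine .tail (ih (by omega)) (mem_scanEdges.2 (.inr (.inl ⟨⟨k, hk⟩, v ⟨k, hk⟩, hybrid u v k, _,
        prefixType_mem_boundedTypes u v (by omega), card_prefixType u v (by omega), ?_⟩)))
      have h1 := hybrid_succ u v ⟨k, hk⟩ (v ⟨k, hk⟩)
      have h2 := prefixType_succ u v ⟨k, hk⟩ (v ⟨k, hk⟩)
      have h3 := hybrid_apply_self u v ⟨k, hk⟩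
      rw [Function.update_eq_self] at h1 h2
      dsimp only at h1 h2 h3
      rw [h1, h2, h3]
  have h := key d le_rfl
  rw [hybrid_full] at h
  exact .tail h (mem_scanEdges.2 (.inr (.inr ⟨u, v, huv, rfl⟩)))

theorem mem_of_scanEdges_reaches {E : Finset ((Fin d → ZMod 2) × (Fin d → ZMod 2))}
    (hE : PermInvariant E)
    {enc : (Fin d → ZMod 2) × Multiset (ZMod 2 × ZMod 2) → ℕ} (henc : Function.Injective enc)
    {u v : Fin d → ZMod 2}
    (h : Relation.ReflTransGen (fun x y => (x, y) ∈ scanEdges E enc)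
      (Sum.inl u) (Sum.inr (Sum.inl v))) : (u, v) ∈ E := by
  have key : ∀ x, Relation.ReflTransGen (fun x y => (x, y) ∈ scanEdges E enc) (Sum.inl u) x →
      x = Sum.inl u ∨
      (∃ k ≤ d, ∃ v, x = Sum.inr (Sum.inr (enc (hybrid u v k, prefixType u v k)))) ∨
      ∃ v, (u, v) ∈ E ∧ x = Sum.inr (Sum.inl v) := by
    intro x hx
    induction hx with
    | refl => exact .inl rfl
    | tail _ hxy ih =>
      rcases mem_scanEdges.1 hxy with ⟨u', h⟩ | ⟨i, b, w, s, -, hi, h⟩ | ⟨u', w, hu', h⟩ <;>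
        obtain ⟨rfl, rfl⟩ := Prod.mk.inj h
      · simp only [Sum.inl.injEq, reduceCtorEq, and_false, exists_false, or_false] at ih
        subst ih
        exact .inr (.inl ⟨0, by omega, u', by rw [hybrid_zero, prefixType_zero]⟩)
      · rcases ih with h | ⟨k, hk, v, h⟩ | ⟨v, -, h⟩
        · cases h
        · obtain ⟨rfl, rfl⟩ := Prod.mk.inj (henc (Sum.inr.inj (Sum.inr.inj h)))
          rw [card_prefixType u v hk] at hi
          subst hi
          refine .inr (.inl ⟨i + 1, i.2, Function.update v i b, ?_⟩)
          rw [hybrid_succ, prefixType_succ, hybrid_apply_self]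
        · cases h
      · rcases ih with h | ⟨k, hk, v, h⟩ | ⟨v, -, h⟩
        · cases h
        · obtain ⟨rfl, h2⟩ := Prod.mk.inj (henc (Sum.inr.inj (Sum.inr.inj h)))
          have hkd := congrArg Multiset.card h2
          rw [card_prefixType _ _ le_rfl, card_prefixType _ _ hk] at hkd
          subst hkd
          rw [hybrid_full] at h2 hu' ⊢
          rw [prefixType_full, prefixType_full] at h2
          obtain ⟨σ, hσ⟩ := exists_perm_of_map_univ_eq h2.symm
          refine .inr (.inr ⟨v, ?_, rfl⟩)
          convert hE _ hu' σ using 2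
          · exact funext fun j => (congrArg Prod.fst (congrFun hσ j)).symm
          · exact funext fun j => (congrArg Prod.snd (congrFun hσ j)).symm
        · cases h
  rcases key _ h with h | ⟨k, -, v', h⟩ | ⟨v', hv, h⟩
  · cases h
  · cases h
  · cases h
    exact hv

theorem rect_le_of_permInvariant (hd : 0 < d)
    {E : Finset ((Fin d → ZMod 2) × (Fin d → ZMod 2))} (hE : PermInvariant E) :
    Rect univ univ E ≤ 4 * 2 ^ d * (d + 1) ^ 5 := by
  obtain ⟨enc, henc⟩ :=
    Countable.exists_injective_nat ((Fin d → ZMod 2) × Multiset (ZMod 2 × ZMod 2))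
  refine le_trans (rect_le_card_of_reachability (scanEdges E enc)
    (Sum.elim (fun _ => 0) (Sum.elim (fun _ => d + 2)
      fun n => (Function.invFun enc n).2.card + 1)) ?_ ?_ ?_ ?_) (card_scanEdges_le hd E enc)
  · intro e he
    have hinv := Function.leftInverse_invFun henc
    rcases mem_scanEdges.1 he with ⟨u, rfl⟩ | ⟨i, b, w, s, -, -, rfl⟩ | ⟨u, w, -, rfl⟩
    · simp
    · simp [hinv _]
    · simp [hinv _, card_prefixType]
  · intro u a h
    simp [mem_scanEdges] at h
  · intro b u h
    simp [mem_scanEdges] at h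
  · exact fun a _ b _ => ⟨scanEdges_reaches, mem_of_scanEdges_reaches hE henc⟩

end Aux

/-- there is a constant `C > 0` such that every permutation invariant
bipartite graph on vertex classes `{0,1}^d` satisfies `Rect(G) ≤ C · 2^d · (d+1)^5`. -/
theorem rect_permInvariant : ∃ C : ℝ, 0 < C ∧ ∀ d : ℕ, 0 < d →
    ∀ E : Finset ((Fin d → ZMod 2) × (Fin d → ZMod 2)), PermInvariant E →
      (Rect (Finset.univ : Finset (Fin d → ZMod 2))
          (Finset.univ : Finset (Fin d → ZMod 2)) E : ℝ) ≤
        C * 2 ^ d * (d + 1) ^ 5 := by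
  refine ⟨4, by norm_num, fun d hd E hE => ?_⟩
  exact_mod_cast rect_le_of_permInvariant hd hE
end

section
/- There is a constant C > 0 such that for every positive even integer d and every permutation invariant bipartite graph G with both vertex classes equal to {0,1}^d, the minimum weight of a biclique covering of G satisfies Cov(G) ≤ C·2^{3d/2}·(d+1)^8. -/
open Finset

section HalfSplit

variable {d : ℕ}

/-- The number of coordinates in `S` at which the pair `(u, v)` takes each of its four values. -/
def pairCount (S : Finset (Fin d)) (u v : Fin d → ZMod 2) (c : ZMod 2 × ZMod 2) : Fin (d + 1) :=
  ⟨(S.filter fun i => (u i, v i) = c).card,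
    Nat.lt_succ_of_le ((card_le_univ _).trans_eq (Fintype.card_fin d))⟩

/-- Vectors that agree with `w` off `S` and have joint counts `t` with `w` on `S`. -/
def leftPart (S : Finset (Fin d)) (w : Fin d → ZMod 2) (t : ZMod 2 × ZMod 2 → Fin (d + 1)) :
    Finset (Fin d → ZMod 2) :=
  univ.filter fun u => (∀ i ∈ Sᶜ, u i = w i) ∧ pairCount S u w = t

/-- Vectors that agree with `w` on `S` and are joined in `E` to all of `leftPart S w t`. -/
def rightPart (E : Finset ((Fin d → ZMod 2) × (Fin d → ZMod 2))) (S : Finset (Fin d))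
    (w : Fin d → ZMod 2) (t : ZMod 2 × ZMod 2 → Fin (d + 1)) : Finset (Fin d → ZMod 2) :=
  univ.filter fun v => (∀ i ∈ S, v i = w i) ∧ ∀ u ∈ leftPart S w t, (u, v) ∈ E

theorem card_filter_agree_le (S : Finset (Fin d)) (w : Fin d → ZMod 2) :
    (univ.filter fun u : Fin d → ZMod 2 => ∀ i ∈ S, u i = w i).card ≤ 2 ^ Sᶜ.card := by
  calc _ ≤ (univ : Finset ((Sᶜ : Finset (Fin d)) → ZMod 2)).card := by
        refine card_le_card_of_injOn (fun u i => u i) (by simp) ?_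
        intro u hu v hv huv
        simp only [coe_filter, mem_univ, true_and, Set.mem_ofPred_eq] at hu hv
        funext i
        by_cases hi : i ∈ S
        · rw [hu i hi, hv i hi]
        · exact congrFun huv ⟨i, mem_compl.2 hi⟩
    _ = 2 ^ Sᶜ.card := by simp [ZMod.card, card_compl]

theorem card_leftPart_le (S : Finset (Fin d)) (w : Fin d → ZMod 2)
    (t : ZMod 2 × ZMod 2 → Fin (d + 1)) : (leftPart S w t).card ≤ 2 ^ S.card := by
  have h := card_filter_agree_le Sᶜ w
  rw [compl_compl] at h
  exact (card_le_card (monotone_filter_right _ fun _ _ hu => hu.1)).trans h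

theorem card_rightPart_le (E : Finset ((Fin d → ZMod 2) × (Fin d → ZMod 2)))
    (S : Finset (Fin d)) (w : Fin d → ZMod 2) (t : ZMod 2 × ZMod 2 → Fin (d + 1)) :
    (rightPart E S w t).card ≤ 2 ^ Sᶜ.card :=
  (card_le_card (monotone_filter_right _ fun _ _ hv => hv.1)).trans (card_filter_agree_le S w)

theorem PermInvariant.mem_of_pairCount_eq {E : Finset ((Fin d → ZMod 2) × (Fin d → ZMod 2))}
    (hE : PermInvariant E) {u v u' v' : Fin d → ZMod 2} (h : (u, v) ∈ E)
    (hc : pairCount univ u v = pairCount univ u' v') : (u', v') ∈ E := by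
  have key : ∀ c, Nonempty ({i // (u' i, v' i) = c} ≃ {i // (u i, v i) = c}) := by
    intro c
    refine Fintype.card_eq.1 ?_
    rw [Fintype.card_subtype, Fintype.card_subtype]
    exact (Fin.ext_iff.1 (congrFun hc c)).symm
  let π : Equiv.Perm (Fin d) := Equiv.ofFiberEquiv fun c => (key c).some
  have hπ : ∀ i, (u (π i), v (π i)) = (u' i, v' i) :=
    Equiv.ofFiberEquiv_map fun c => (key c).some
  have hmem := hE _ h π
  rwa [show u ∘ π = u' from funext fun i => congrArg Prod.fst (hπ i),
    show v ∘ π = v' from funext fun i => congrArg Prod.snd (hπ i)] at hmem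

theorem pairCount_congr {S : Finset (Fin d)} {u v u' v' : Fin d → ZMod 2}
    (hu : ∀ i ∈ S, u i = u' i) (hv : ∀ i ∈ S, v i = v' i) :
    pairCount S u v = pairCount S u' v' := by
  funext c
  refine Fin.ext (congrArg card (filter_congr fun i hi => ?_))
  rw [hu i hi, hv i hi]

theorem pairCount_univ_eq {S : Finset (Fin d)} {u v u' v' : Fin d → ZMod 2}
    (h₁ : pairCount S u v = pairCount S u' v') (h₂ : pairCount Sᶜ u v = pairCount Sᶜ u' v') :
    pairCount univ u v = pairCount univ u' v' := by
  funext c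
  have h₁' := Fin.ext_iff.1 (congrFun h₁ c)
  have h₂' := Fin.ext_iff.1 (congrFun h₂ c)
  simp only [pairCount, card_filter] at h₁' h₂' ⊢
  refine Fin.ext ?_
  simp only
  rw [← sum_add_sum_compl S, ← sum_add_sum_compl S, h₁', h₂']

theorem exists_mem_leftPart_rightPart {E : Finset ((Fin d → ZMod 2) × (Fin d → ZMod 2))}
    (hE : PermInvariant E) (S : Finset (Fin d)) {u v : Fin d → ZMod 2} (h : (u, v) ∈ E) :
    ∃ w t, u ∈ leftPart S w t ∧ v ∈ rightPart E S w t := by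
  let w := S.piecewise v u
  have hwS : ∀ i ∈ S, v i = w i := fun i hi => (piecewise_eq_of_mem S v u hi).symm
  have hwC : ∀ i ∈ Sᶜ, u i = w i := fun i hi =>
    (piecewise_eq_of_notMem S v u (mem_compl.1 hi)).symm
  refine ⟨w, pairCount S u w, mem_filter.2 ⟨mem_univ _, hwC, rfl⟩,
    mem_filter.2 ⟨mem_univ _, hwS, fun u' hu' => ?_⟩⟩
  obtain ⟨-, hu'C, hu'S⟩ := mem_filter.1 hu'
  refine hE.mem_of_pairCount_eq h (pairCount_univ_eq (S := S) ?_ ?_)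
  · rw [pairCount_congr (fun _ _ => rfl) hwS, ← hu'S, pairCount_congr (fun _ _ => rfl) hwS]
  · exact pairCount_congr (fun i hi => (hwC i hi).trans (hu'C i hi).symm) fun _ _ => rfl

/-- Any split of the coordinates into `S` and its complement gives a biclique covering. -/
theorem PermInvariant.cov_le {E : Finset ((Fin d → ZMod 2) × (Fin d → ZMod 2))}
    (hE : PermInvariant E) (S : Finset (Fin d)) :
    Cov univ univ E ≤ 2 ^ d * (d + 1) ^ 4 * (2 ^ S.card + 2 ^ Sᶜ.card) := by
  let f : (Fin d → ZMod 2) × (ZMod 2 × ZMod 2 → Fin (d + 1)) →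
      Finset (Fin d → ZMod 2) × Finset (Fin d → ZMod 2) :=
    fun x => (leftPart S x.1 x.2, rightPart E S x.1 x.2)
  have hcover : IsBicliqueCover univ univ E (univ.image f) := by
    refine ⟨fun p hp => ?_, fun e he => ?_⟩
    · obtain ⟨x, -, rfl⟩ := mem_image.1 hp
      refine ⟨subset_univ _, subset_univ _, fun e he => ?_⟩
      obtain ⟨h₁, h₂⟩ := mem_product.1 he
      exact (mem_filter.1 h₂).2.2 _ h₁
    · obtain ⟨w, t, h₁, h₂⟩ := exists_mem_leftPart_rightPart hE S (u := e.1) (v := e.2) he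
      exact ⟨f (w, t), mem_image_of_mem f (mem_univ _), h₁, h₂⟩
  calc Cov univ univ E ≤ ∑ p ∈ univ.image f, (p.1.card + p.2.card) :=
        Nat.sInf_le ⟨_, hcover, rfl⟩
    _ ≤ (univ.image f).card • (2 ^ S.card + 2 ^ Sᶜ.card) := by
        refine sum_le_card_nsmul _ _ _ fun p hp => ?_
        obtain ⟨x, -, rfl⟩ := mem_image.1 hp
        exact Nat.add_le_add (card_leftPart_le S _ _) (card_rightPart_le E S _ _)
    _ ≤ 2 ^ d * (d + 1) ^ 4 * (2 ^ S.card + 2 ^ Sᶜ.card) := by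
        rw [smul_eq_mul]
        refine Nat.mul_le_mul_right _ (card_image_le.trans_eq ?_)
        simp [ZMod.card]

end HalfSplit

/-- there is a constant `C > 0` such that every permutation invariant
bipartite graph on vertex classes `{0,1}^d`, `d` even and positive, satisfies
`Cov(G) ≤ C · 2^(3d/2) · (d+1)^8`. -/
theorem cov_permInvariant : ∃ C : ℝ, 0 < C ∧ ∀ d : ℕ, 0 < d → Even d →
    ∀ E : Finset ((Fin d → ZMod 2) × (Fin d → ZMod 2)), PermInvariant E →
      (Cov (Finset.univ : Finset (Fin d → ZMod 2))
          (Finset.univ : Finset (Fin d → ZMod 2)) E : ℝ) ≤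
        C * 2 ^ (3 * (d / 2)) * (d + 1) ^ 8 := by
  refine ⟨2, two_pos, fun d _ hd E hE => ?_⟩
  obtain ⟨m, rfl⟩ := hd
  obtain ⟨S, -, hS⟩ := exists_subset_card_eq (s := (univ : Finset (Fin (m + m)))) (n := m)
    (by simp)
  have h := hE.cov_le S
  rw [card_compl, Fintype.card_fin, hS, Nat.add_sub_cancel] at h
  have hm : (m + m) / 2 = m := by omega
  rw [hm]
  calc (Cov univ univ E : ℝ)
      ≤ 2 ^ (m + m) * (((m + m : ℕ) : ℝ) + 1) ^ 4 * (2 ^ m + 2 ^ m) := by exact_mod_cast h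
    _ = 2 * 2 ^ (3 * m) * (((m + m : ℕ) : ℝ) + 1) ^ 4 := by ring
    _ ≤ 2 * 2 ^ (3 * m) * (((m + m : ℕ) : ℝ) + 1) ^ 8 := by
        gcongr
        · exact le_add_of_nonneg_left (Nat.cast_nonneg _)
        · norm_num
end

section
/- Let G = (A,B,E) be a finite bipartite graph with at least one edge and no isolated vertices, and let 0 < α ≤ 1. If Cov(G) ≤ |E|/κ(G)^α, then Cov(G) ≤ 2·Rect(G)^{1 + 1/(1+α)}. -/
open Finset

open Classical in
/-- The depth-one rectifier network whose edges are those of the graph itself. -/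
noncomputable def RectNet.ofGraph {α β : Type*} (A : Finset α) (B : Finset β)
    (E : Finset (α × β)) (hE : E ⊆ A ×ˢ B)
    (hA : ∀ a ∈ A, ∃ b ∈ B, (a, b) ∈ E) (hB : ∀ b ∈ B, ∃ a ∈ A, (a, b) ∈ E) :
    RectNet A B E where
  V := A.image Sum.inl ∪ B.image (fun b => Sum.inr (Sum.inl b))
  Ed := E.image (fun e => (Sum.inl e.1, Sum.inr (Sum.inl e.2)))
  mem_fst := by
    intro e he
    obtain ⟨p, hp, rfl⟩ := Finset.mem_image.1 he
    have := Finset.mem_product.1 (hE hp)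
    simp [this.1]
  mem_snd := by
    intro e he
    obtain ⟨p, hp, rfl⟩ := Finset.mem_image.1 he
    have := Finset.mem_product.1 (hE hp)
    simp [this.2]
  acyclic := by
    intro v hv
    obtain ⟨x, hx, -⟩ := Relation.TransGen.head'_iff.1 hv
    obtain ⟨y, -, hy⟩ := Relation.TransGen.tail'_iff.1 hv
    obtain ⟨p, -, hp⟩ := Finset.mem_image.1 hx
    obtain ⟨q, -, hq⟩ := Finset.mem_image.1 hy
    have h1 := congrArg Prod.fst hp
    have h2 := congrArg Prod.snd hq
    exact absurd (h1.trans h2.symm) (by simp)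
  memA := by intro a ha; simp [ha]
  memB := by intro b hb; simp [hb]
  sources := by
    intro v hv
    constructor
    · intro h
      rcases Finset.mem_union.1 hv with hv | hv
      · obtain ⟨a, ha, rfl⟩ := Finset.mem_image.1 hv
        exact ⟨a, ha, rfl⟩
      · obtain ⟨b, hb, rfl⟩ := Finset.mem_image.1 hv
        obtain ⟨a, -, hab⟩ := hB b hb
        exact absurd (Finset.mem_image.2 ⟨(a, b), hab, rfl⟩) (h _)
    · rintro ⟨a, -, rfl⟩ u hu
      obtain ⟨p, -, hp⟩ := Finset.mem_image.1 hu
      exact absurd (congrArg Prod.snd hp) (by simp)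
  sinks := by
    intro v hv
    constructor
    · intro h
      rcases Finset.mem_union.1 hv with hv | hv
      · obtain ⟨a, ha, rfl⟩ := Finset.mem_image.1 hv
        obtain ⟨b, -, hab⟩ := hA a ha
        exact absurd (Finset.mem_image.2 ⟨(a, b), hab, rfl⟩) (h _)
      · obtain ⟨b, hb, rfl⟩ := Finset.mem_image.1 hv
        exact ⟨b, hb, rfl⟩
    · rintro ⟨b, -, rfl⟩ u hu
      obtain ⟨p, -, hp⟩ := Finset.mem_image.1 hu
      exact absurd (congrArg Prod.fst hp) (by simp)
  realizes := by
    intro a _ b _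
    constructor
    · intro h
      exact Relation.ReflTransGen.single (Finset.mem_image.2 ⟨(a, b), h, rfl⟩)
    · intro h
      obtain h | ⟨w, h1, h2⟩ := Relation.ReflTransGen.cases_head h
      · simp at h
      · obtain ⟨⟨x, y⟩, hp, hpe⟩ := Finset.mem_image.1 h1
        obtain ⟨hp1, rfl⟩ := Prod.mk.inj hpe
        obtain heq | ⟨_, h3, -⟩ := Relation.ReflTransGen.cases_head h2
        · obtain rfl : x = a := Sum.inl.inj hp1
          obtain rfl : b = y := (Sum.inl.inj (Sum.inr.inj heq)).symm
          exact hp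
        · obtain ⟨q, -, hq⟩ := Finset.mem_image.1 h3
          exact absurd (congrArg Prod.fst hq) (by simp)

theorem div_le_kappa {α β : Type*} {A : Finset α} {B : Finset β} {E : Finset (α × β)}
    {p : Finset α × Finset β} (hp : IsBiclique A B E p) (h1 : p.1.Nonempty) (h2 : p.2.Nonempty) :
    ((p.1.card : ℝ) * (p.2.card : ℝ)) / ((p.1.card : ℝ) + (p.2.card : ℝ)) ≤ kappa A B E := by
  refine le_csSup ⟨A.card, ?_⟩ ⟨p, hp, h1, h2, rfl⟩
  rintro _ ⟨q, hq, hq1, hq2, rfl⟩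
  have hx : (0 : ℝ) < q.1.card := by exact_mod_cast hq1.card_pos
  have hy : (0 : ℝ) < q.2.card := by exact_mod_cast hq2.card_pos
  have hxA : (q.1.card : ℝ) ≤ A.card := by exact_mod_cast Finset.card_le_card hq.1
  rw [div_le_iff₀ (by positivity)]
  nlinarith

/-- One side of every nonempty biclique has at most `2 κ(G)` vertices. -/
theorem card_snd_le_two_mul_kappa {α β : Type*} {A : Finset α} {B : Finset β}
    {E : Finset (α × β)} {p : Finset α × Finset β} (hp : IsBiclique A B E p)
    (h1 : p.1.Nonempty) (h2 : p.2.Nonempty) (h : 2 * kappa A B E < p.1.card) :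
    (p.2.card : ℝ) ≤ 2 * kappa A B E := by
  have hk := div_le_kappa hp h1 h2
  have hx : (0 : ℝ) < p.1.card := by exact_mod_cast h1.card_pos
  have hy : (0 : ℝ) < p.2.card := by exact_mod_cast h2.card_pos
  rw [div_le_iff₀ (by positivity)] at hk
  by_contra! hlt
  nlinarith [mul_lt_mul_of_pos_right h hy, mul_lt_mul_of_pos_right hlt hx]

theorem one_le_two_mul_kappa {α β : Type*} {A : Finset α} {B : Finset β} {E : Finset (α × β)}
    (hE : E ⊆ A ×ˢ B) (hne : E.Nonempty) : 1 ≤ 2 * kappa A B E := by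
  obtain ⟨⟨x, y⟩, hxy⟩ := hne
  have hm := Finset.mem_product.1 (hE hxy)
  have := div_le_kappa (A := A) (B := B) (E := E) (p := ({x}, {y}))
    ⟨by simpa using hm.1, by simpa using hm.2, by simpa using hxy⟩ (by simp) (by simp)
  norm_num at this
  linarith

namespace RectNet

variable {α β : Type*} {A : Finset α} {B : Finset β} {E : Finset (α × β)}

/-- Reachability by directed paths. -/
def Reach (R : RectNet A B E) : RVert α β → RVert α β → Prop :=
  Relation.ReflTransGen (fun x y => (x, y) ∈ R.Ed)

open Classical in
/-- The sources from which `v` is reachable. -/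
noncomputable def anc (R : RectNet A B E) (v : RVert α β) : Finset α :=
  A.filter (fun a => R.Reach (Sum.inl a) v)

open Classical in
/-- The sinks reachable from `v`. -/
noncomputable def desc (R : RectNet A B E) (v : RVert α β) : Finset β :=
  B.filter (fun b => R.Reach v (Sum.inr (Sum.inl b)))

variable (R : RectNet A B E)

theorem mem_anc {v : RVert α β} {a : α} : a ∈ R.anc v ↔ a ∈ A ∧ R.Reach (Sum.inl a) v := by
  simp [anc]

theorem mem_desc {v : RVert α β} {b : β} :
    b ∈ R.desc v ↔ b ∈ B ∧ R.Reach v (Sum.inr (Sum.inl b)) := by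
  simp [desc]

theorem isBiclique_anc_desc {u v : RVert α β} (h : R.Reach u v) :
    IsBiclique A B E (R.anc u, R.desc v) := by
  refine ⟨fun a ha => (R.mem_anc.1 ha).1, fun b hb => (R.mem_desc.1 hb).1, ?_⟩
  rintro ⟨a, b⟩ hab
  obtain ⟨ha, hb⟩ := Finset.mem_product.1 hab
  obtain ⟨haA, har⟩ := R.mem_anc.1 ha
  obtain ⟨hbB, hbr⟩ := R.mem_desc.1 hb
  exact (R.realizes a haA b hbB).2 ((har.trans h).trans hbr)

theorem anc_source {a : α} (ha : a ∈ A) : R.anc (Sum.inl a) = {a} := by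
  ext x
  rw [mem_anc, Finset.mem_singleton]
  constructor
  · rintro ⟨-, h⟩
    obtain h | ⟨w, -, h⟩ := Relation.ReflTransGen.cases_tail h
    · exact (Sum.inl.inj h).symm
    · exact absurd h ((R.sources _ (R.memA a ha)).2 ⟨a, ha, rfl⟩ w)
  · rintro rfl
    exact ⟨ha, Relation.ReflTransGen.refl⟩

theorem desc_sink {b : β} (hb : b ∈ B) : R.desc (Sum.inr (Sum.inl b)) = {b} := by
  ext x
  rw [mem_desc, Finset.mem_singleton]
  constructor
  · rintro ⟨-, h⟩
    obtain h | ⟨w, h, -⟩ := Relation.ReflTransGen.cases_head h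
    · exact (Sum.inl.inj (Sum.inr.inj h)).symm
    · exact absurd h ((R.sinks _ (R.memB b hb)).2 ⟨b, hb, rfl⟩ w)
  · rintro rfl
    exact ⟨hb, Relation.ReflTransGen.refl⟩

theorem card_left_le_size : A.card ≤ R.size := by
  classical
  calc A.card = (A.image (Sum.inl : α → RVert α β)).card :=
        (Finset.card_image_of_injective _ Sum.inl_injective).symm
    _ ≤ (R.Ed.image Prod.fst).card := by
        refine Finset.card_le_card fun v hv => ?_
        obtain ⟨a, ha, rfl⟩ := Finset.mem_image.1 hv
        have h := mt (R.sinks _ (R.memA a ha)).1 (by simp)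
        push Not at h
        obtain ⟨u, hu⟩ := h
        exact Finset.mem_image.2 ⟨_, hu, rfl⟩
    _ ≤ R.size := Finset.card_image_le

theorem card_right_le_size : B.card ≤ R.size := by
  classical
  calc B.card = (B.image (fun b => (Sum.inr (Sum.inl b) : RVert α β))).card :=
        (Finset.card_image_of_injective _ (Sum.inr_injective.comp Sum.inl_injective)).symm
    _ ≤ (R.Ed.image Prod.snd).card := by
        refine Finset.card_le_card fun v hv => ?_
        obtain ⟨b, hb, rfl⟩ := Finset.mem_image.1 hv
        have h := mt (R.sources _ (R.memB b hb)).1 (by simp)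
        push Not at h
        obtain ⟨u, hu⟩ := h
        exact Finset.mem_image.2 ⟨_, hu, rfl⟩
    _ ≤ R.size := Finset.card_image_le

/-- On each path from a vertex with few ancestors to a sink `b` some edge `(x, y)` has both few
ancestors of `x` and few descendants of `y`. -/
theorem exists_light_edge (hκ : 1 ≤ 2 * kappa A B E) {a : α} {b : β} (ha : a ∈ A) (hb : b ∈ B)
    {u : RVert α β} (hub : R.Reach u (Sum.inr (Sum.inl b))) (hne : u ≠ Sum.inr (Sum.inl b))
    (hau : R.Reach (Sum.inl a) u) (hu : ((R.anc u).card : ℝ) ≤ 2 * kappa A B E) :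
    ∃ e ∈ R.Ed, a ∈ R.anc e.1 ∧ b ∈ R.desc e.2 ∧
      ((R.anc e.1).card + (R.desc e.2).card : ℝ) ≤ 4 * kappa A B E := by
  induction hub using Relation.ReflTransGen.head_induction_on with
  | refl => exact absurd rfl hne
  | @head u w huw hwb ih =>
    have haw : R.Reach (Sum.inl a) w := hau.tail huw
    have light (h : ((R.desc w).card : ℝ) ≤ 2 * kappa A B E) :
        ∃ e ∈ R.Ed, a ∈ R.anc e.1 ∧ b ∈ R.desc e.2 ∧
          ((R.anc e.1).card + (R.desc e.2).card : ℝ) ≤ 4 * kappa A B E :=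
      ⟨(u, w), huw, R.mem_anc.2 ⟨ha, hau⟩, R.mem_desc.2 ⟨hb, hwb⟩, by dsimp only; linarith⟩
    by_cases hw : ((R.anc w).card : ℝ) ≤ 2 * kappa A B E
    · by_cases hwe : w = Sum.inr (Sum.inl b)
      · exact light (by simpa [hwe, R.desc_sink hb] using hκ)
      · exact ih hwe haw hw
    · exact light (card_snd_le_two_mul_kappa
        (R.isBiclique_anc_desc Relation.ReflTransGen.refl)
        ⟨a, R.mem_anc.2 ⟨ha, haw⟩⟩ ⟨b, R.mem_desc.2 ⟨hb, hwb⟩⟩ (not_le.1 hw))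

theorem cov_le (hE : E ⊆ A ×ˢ B) (hne : E.Nonempty) :
    (Cov A B E : ℝ) ≤ 4 * kappa A B E * R.size := by
  classical
  have hκ := one_le_two_mul_kappa hE hne
  set F := R.Ed.filter (fun e => ((R.anc e.1).card + (R.desc e.2).card : ℝ) ≤ 4 * kappa A B E)
    with hF
  set C := F.image (fun e => (R.anc e.1, R.desc e.2)) with hC
  have hcover : IsBicliqueCover A B E C := by
    constructor
    · intro p hp
      obtain ⟨e, he, rfl⟩ := Finset.mem_image.1 hp
      exact R.isBiclique_anc_desc (Relation.ReflTransGen.single (Finset.mem_filter.1 he).1)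
    · rintro ⟨x, y⟩ hxy
      obtain ⟨hx, hy⟩ := Finset.mem_product.1 (hE hxy)
      obtain ⟨e, he, h1, h2, h3⟩ := R.exists_light_edge hκ hx hy
        ((R.realizes x hx y hy).1 hxy) (by simp) Relation.ReflTransGen.refl
        (by simpa [R.anc_source hx] using hκ)
      exact ⟨_, Finset.mem_image.2 ⟨e, Finset.mem_filter.2 ⟨he, h3⟩, rfl⟩, h1, h2⟩
  have hcard : (C.card : ℝ) ≤ R.size := by
    exact_mod_cast Finset.card_image_le.trans (Finset.card_filter_le _ _)
  calc (Cov A B E : ℝ) ≤ ((∑ p ∈ C, (p.1.card + p.2.card) : ℕ) : ℝ) := by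
        have h : Cov A B E ≤ ∑ p ∈ C, (p.1.card + p.2.card) := Nat.sInf_le ⟨C, hcover, rfl⟩
        exact_mod_cast h
    _ = ∑ p ∈ C, ((p.1.card : ℝ) + p.2.card) := by push_cast; rfl
    _ ≤ C.card • (4 * kappa A B E) := by
        refine Finset.sum_le_card_nsmul _ _ _ fun p hp => ?_
        obtain ⟨e, he, rfl⟩ := Finset.mem_image.1 hp
        exact (Finset.mem_filter.1 he).2
    _ = 4 * kappa A B E * C.card := by rw [nsmul_eq_mul, mul_comm]
    _ ≤ 4 * kappa A B E * R.size := mul_le_mul_of_nonneg_left hcard (by linarith)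

end RectNet

/-- Interpolation between `c ≤ e / k ^ a` and `c ≤ 4 * k * r` when `e ≤ r ^ 2`. -/
theorem le_two_mul_rpow_of_le_div_of_le_mul {a c e k r : ℝ} (ha0 : 0 < a) (ha1 : a ≤ 1)
    (hc : 0 ≤ c) (hk : 0 < k) (hr : 0 ≤ r) (her : e ≤ r ^ 2) (h1 : c ≤ e / k ^ a)
    (h2 : c ≤ 4 * k * r) : c ≤ 2 * r ^ (1 + 1 / (1 + a)) := by
  have hka : 0 < k ^ a := Real.rpow_pos_of_pos hk a
  have hpow : c ^ (1 + a) ≤ (2 * r ^ (1 + 1 / (1 + a))) ^ (1 + a) := by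
    calc c ^ (1 + a) = c * c ^ a := by
          rw [Real.rpow_add_of_nonneg hc zero_le_one ha0.le, Real.rpow_one]
      _ ≤ (r ^ 2 / k ^ a) * (4 * k * r) ^ a := by
          gcongr
          exact h1.trans (by gcongr)
      _ = 4 ^ a * (r ^ 2 * r ^ a) := by
          rw [Real.mul_rpow (by positivity) hr, Real.mul_rpow (by norm_num) hk.le]
          field_simp
      _ = 2 ^ (2 * a) * (r ^ 2 * r ^ a) := by
          rw [Real.rpow_mul (by norm_num)]
          norm_num
      _ ≤ 2 ^ (1 + a) * (r ^ 2 * r ^ a) := by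
          gcongr
          · norm_num
          · linarith
      _ = (2 * r ^ (1 + 1 / (1 + a))) ^ (1 + a) := by
          rw [Real.mul_rpow (by norm_num) (by positivity), ← Real.rpow_mul hr,
            ← Real.rpow_natCast r 2, ← Real.rpow_add_of_nonneg hr (by norm_num) ha0.le]
          congr 2
          field_simp
          push_cast
          ring
  exact (Real.rpow_le_rpow_iff hc (by positivity) (by positivity)).1 hpow

/-- Let `G = (A, B, E)` be a finite bipartite graph with at least one edge
and no isolated vertices, and let `0 < α ≤ 1`. If `Cov(G) ≤ |E| / κ(G)^α`, then
`Cov(G) ≤ 2 · Rect(G)^(1 + 1/(1+α))`. -/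
theorem cov_le_two_rect_rpow {α β : Type*} (A : Finset α) (B : Finset β)
    (E : Finset (α × β)) (hE : E ⊆ A ×ˢ B) (hne : E.Nonempty)
    (hA : ∀ a ∈ A, ∃ b ∈ B, (a, b) ∈ E) (hB : ∀ b ∈ B, ∃ a ∈ A, (a, b) ∈ E)
    (a : ℝ) (ha0 : 0 < a) (ha1 : a ≤ 1)
    (hcov : (Cov A B E : ℝ) ≤ (E.card : ℝ) / kappa A B E ^ a) :
    (Cov A B E : ℝ) ≤ 2 * (Rect A B E : ℝ) ^ (1 + 1 / (1 + a)) := by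
  obtain ⟨R, hR⟩ : ∃ R : RectNet A B E, R.size = Rect A B E :=
    Nat.sInf_mem (s := {n | ∃ R : RectNet A B E, R.size = n})
      ⟨_, RectNet.ofGraph A B E hE hA hB, rfl⟩
  have hcard : E.card ≤ Rect A B E ^ 2 := by
    calc E.card ≤ (A ×ˢ B).card := Finset.card_le_card hE
      _ = A.card * B.card := Finset.card_product A B
      _ ≤ Rect A B E ^ 2 := by
          rw [sq, ← hR]
          exact Nat.mul_le_mul R.card_left_le_size R.card_right_le_size
  have hκ := one_le_two_mul_kappa hE hne
  refine le_two_mul_rpow_of_le_div_of_le_mul ha0 ha1 (by positivity) (by linarith)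
    (by positivity) (by exact_mod_cast hcard) hcov ?_
  rw [← hR]
  exact R.cov_le hE hne
end

section
/- In the weighted set cover problem, there exists a cover of the universe A whose total cost is at most H_n·η*, where n = |A|; in particular OPT ≤ H_n·η*. -/
open Finset

section SetCover

variable {γ : Type*} [DecidableEq γ]

/-- `η(B)`: the minimum of `c(Sᵢ)/|Sᵢ ∩ B|` over those `i` with `Sᵢ ∩ B ≠ ∅`. -/
noncomputable def eta {t : ℕ} (S : Fin t → Finset γ) (c : Fin t → ℝ) (B : Finset γ) : ℝ :=
  sInf {r | ∃ i, (S i ∩ B).Nonempty ∧ r = c i / ((S i ∩ B).card : ℝ)}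

/-- `η*`: the maximum of `|B| · η(B)` over nonempty subsets `B` of the universe `A`. -/
noncomputable def etaStar {t : ℕ} (A : Finset γ) (S : Fin t → Finset γ)
    (c : Fin t → ℝ) : ℝ :=
  sSup {r | ∃ B : Finset γ, B.Nonempty ∧ B ⊆ A ∧ r = (B.card : ℝ) * eta S c B}

/-- `OPT`: the minimum total cost of a subcollection of the `Sᵢ` covering `A`. -/
noncomputable def setCoverOPT {t : ℕ} (A : Finset γ) (S : Fin t → Finset γ)
    (c : Fin t → ℝ) : ℝ :=
  sInf {r | ∃ C : Finset (Fin t), (∀ a ∈ A, ∃ i ∈ C, a ∈ S i) ∧ r = ∑ i ∈ C, c i}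

end SetCover

theorem exists_eta_eq {γ : Type*} [DecidableEq γ] {t : ℕ} (S : Fin t → Finset γ)
    (c : Fin t → ℝ) (B : Finset γ) (h : ∃ i, (S i ∩ B).Nonempty) :
    ∃ i, (S i ∩ B).Nonempty ∧ eta S c B = c i / ((S i ∩ B).card : ℝ) := by
  have hfin : {r | ∃ i, (S i ∩ B).Nonempty ∧ r = c i / ((S i ∩ B).card : ℝ)}.Finite :=
    (Set.finite_range fun i => c i / ((S i ∩ B).card : ℝ)).subset
      fun r ⟨i, _, hr⟩ => ⟨i, hr.symm⟩
  have hne : {r | ∃ i, (S i ∩ B).Nonempty ∧ r = c i / ((S i ∩ B).card : ℝ)}.Nonempty :=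
    h.imp' _ fun i hi => ⟨i, hi, rfl⟩
  exact hne.csInf_mem hfin

theorem card_mul_eta_le_etaStar {γ : Type*} [DecidableEq γ] {t : ℕ} {A B : Finset γ}
    (S : Fin t → Finset γ) (c : Fin t → ℝ) (hB : B.Nonempty) (hBA : B ⊆ A) :
    (B.card : ℝ) * eta S c B ≤ etaStar A S c := by
  refine le_csSup (Set.Finite.bddAbove ?_) ⟨B, hB, hBA, rfl⟩
  refine (A.powerset.finite_toSet.image fun B => (B.card : ℝ) * eta S c B).subset ?_
  rintro r ⟨B, -, hBA, rfl⟩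
  exact ⟨B, by simpa using hBA, rfl⟩

theorem etaStar_nonneg {γ : Type*} [DecidableEq γ] {t : ℕ} (A : Finset γ)
    (S : Fin t → Finset γ) {c : Fin t → ℝ} (hc : ∀ i, 0 ≤ c i) : 0 ≤ etaStar A S c := by
  refine Real.sSup_nonneg ?_
  rintro r ⟨B, -, -, rfl⟩
  refine mul_nonneg (Nat.cast_nonneg _) (Real.sInf_nonneg ?_)
  rintro r ⟨i, -, rfl⟩
  exact div_nonneg (hc i) (Nat.cast_nonneg _)

theorem sum_range_one_div_add_div_le (m k : ℕ) :
    ∑ i ∈ Finset.range m, (1 : ℝ) / (i + 1) + (k : ℝ) / (m + k : ℕ) ≤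
      ∑ i ∈ Finset.range (m + k), (1 : ℝ) / (i + 1) := by
  rw [Finset.sum_range_add]
  gcongr
  calc (k : ℝ) / (m + k : ℕ) = ∑ _i ∈ Finset.range k, (1 : ℝ) / (m + k : ℕ) := by
        simp [div_eq_mul_inv]
    _ ≤ _ := by
        refine Finset.sum_le_sum fun i hi => ?_
        have : i + 1 ≤ k := Finset.mem_range.1 hi
        refine one_div_le_one_div_of_le (by positivity) ?_
        exact_mod_cast (by omega : m + i + 1 ≤ m + k)

/-- The greedy bound, for covering any subset of the universe. -/
theorem exists_cover_subset_cost_le {γ : Type*} [DecidableEq γ] {t : ℕ} {A : Finset γ}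
    {S : Fin t → Finset γ} (hScov : ∀ a ∈ A, ∃ i, a ∈ S i)
    {c : Fin t → ℝ} (hc : ∀ i, 0 ≤ c i) (B : Finset γ) (hBA : B ⊆ A) :
    ∃ C : Finset (Fin t), (∀ a ∈ B, ∃ i ∈ C, a ∈ S i) ∧
      ∑ i ∈ C, c i ≤ (∑ i ∈ Finset.range B.card, (1 : ℝ) / (i + 1)) * etaStar A S c := by
  induction B using Finset.strongInduction with
  | H B ih =>
    rcases B.eq_empty_or_nonempty with rfl | hB
    · exact ⟨∅, by simp⟩
    obtain ⟨b, hb⟩ := hB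
    obtain ⟨j, hj⟩ := hScov b (hBA hb)
    obtain ⟨i, hi, heta⟩ := exists_eta_eq S c B ⟨j, b, Finset.mem_inter.2 ⟨hj, hb⟩⟩
    obtain ⟨x, hx⟩ := hi
    obtain ⟨hxS, hxB⟩ := Finset.mem_inter.1 hx
    obtain ⟨C, hC, hcost⟩ := ih (B \ S i)
      (Finset.ssubset_iff_of_subset Finset.sdiff_subset |>.2 ⟨x, hxB, by simp [hxS]⟩)
      (Finset.sdiff_subset.trans hBA)
    have hcard : (B \ S i).card + (S i ∩ B).card = B.card := by
      rw [Finset.inter_comm]; exact Finset.card_sdiff_add_card_inter B (S i)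
    refine ⟨insert i C, fun a ha => ?_, ?_⟩
    · by_cases haS : a ∈ S i
      · exact ⟨i, Finset.mem_insert_self _ _, haS⟩
      · obtain ⟨l, hl, hal⟩ := hC a (Finset.mem_sdiff.2 ⟨ha, haS⟩)
        exact ⟨l, Finset.mem_insert_of_mem hl, hal⟩
    have hstar := card_mul_eta_le_etaStar S c ⟨b, hb⟩ hBA
    have hBpos : (0 : ℝ) < B.card := by exact_mod_cast Finset.card_pos.2 ⟨b, hb⟩
    have hkpos : (0 : ℝ) < (S i ∩ B).card := by exact_mod_cast Finset.card_pos.2 ⟨x, hx⟩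
    have hci : c i ≤ ((S i ∩ B).card : ℝ) / B.card * etaStar A S c := by
      calc c i = ((S i ∩ B).card : ℝ) / B.card * (B.card * eta S c B) := by
            rw [heta]; field_simp
        _ ≤ _ := by gcongr
    have hharm := sum_range_one_div_add_div_le (B \ S i).card (S i ∩ B).card
    rw [hcard] at hharm
    calc ∑ l ∈ insert i C, c l ≤ c i + ∑ l ∈ C, c l := by
          by_cases hiC : i ∈ C
          · rw [Finset.insert_eq_of_mem hiC]; linarith [hc i]
          · rw [Finset.sum_insert hiC]
      _ ≤ (∑ l ∈ Finset.range (B \ S i).card, (1 : ℝ) / (l + 1) +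
            ((S i ∩ B).card : ℝ) / B.card) * etaStar A S c := by
          rw [add_mul]; linarith
      _ ≤ _ := mul_le_mul_of_nonneg_right hharm (etaStar_nonneg A S hc)

theorem setCoverOPT_le {γ : Type*} [DecidableEq γ] {t : ℕ} {A : Finset γ}
    {S : Fin t → Finset γ} {c : Fin t → ℝ} (hc : ∀ i, 0 ≤ c i) {C : Finset (Fin t)}
    (hC : ∀ a ∈ A, ∃ i ∈ C, a ∈ S i) : setCoverOPT A S c ≤ ∑ i ∈ C, c i := by
  refine csInf_le ⟨0, ?_⟩ ⟨C, hC, rfl⟩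
  rintro r ⟨D, -, rfl⟩
  exact Finset.sum_nonneg fun i _ => hc i

/-- in the weighted set cover problem there exists a cover of `A` of total
cost at most `H_n · η*`, where `n = |A|` and `H_n = ∑_{i=1}^n 1/i`; in particular
`OPT ≤ H_n · η*`. -/
theorem exists_cover_cost_le_harmonic_mul_etaStar {γ : Type*} [DecidableEq γ] {t : ℕ}
    (A : Finset γ) (hA : A.Nonempty)
    (S : Fin t → Finset γ) (hSsub : ∀ i, S i ⊆ A) (hScov : ∀ a ∈ A, ∃ i, a ∈ S i)
    (c : Fin t → ℝ) (hc : ∀ i, 0 < c i) :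
    (∃ C : Finset (Fin t), (∀ a ∈ A, ∃ i ∈ C, a ∈ S i) ∧
      ∑ i ∈ C, c i ≤ (∑ i ∈ Finset.range A.card, (1 : ℝ) / (i + 1)) * etaStar A S c) ∧
    setCoverOPT A S c ≤ (∑ i ∈ Finset.range A.card, (1 : ℝ) / (i + 1)) * etaStar A S c := by
  obtain ⟨C, hC, hcost⟩ := exists_cover_subset_cost_le hScov (fun i => (hc i).le) A subset_rfl
  exact ⟨⟨C, hC, hcost⟩, (setCoverOPT_le (fun i => (hc i).le) hC).trans hcost⟩
end

section
/- Let A and B be disjoint finite alphabets and let L ⊆ AB be a language of two-letter words such that every letter of A is the first letter of some word of L and every letter of B is the second letter of some word of L. Then there exists an NFA M (with ε-transitions allowed) recognizing L whose number of transitions satisfies |M| ≤ Rect(G_L) + |A| + |B|. -/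
open Finset

section NFADefs

variable {σ : Type*}

/-- A nondeterministic finite automaton over the alphabet `σ`, with states drawn from `ℕ`
(the state set is the finite set `states`). Transition labels are `Option σ`, where
`none` stands for `ε`. -/
structure NFA0 (σ : Type*) where
  states : Finset ℕ
  start : ℕ
  accept : Finset ℕ
  trans : Finset (ℕ × Option σ × ℕ)
  start_mem : start ∈ states
  accept_sub : accept ⊆ states
  trans_fst : ∀ t ∈ trans, t.1 ∈ states
  trans_snd : ∀ t ∈ trans, t.2.2 ∈ states

/-- An NFA is `ε`-free if none of its transitions is labelled `ε`. -/
def NFA0.EpsFree (M : NFA0 σ) : Prop := ∀ t ∈ M.trans, t.2.1 ≠ none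

/-- The size of an NFA: its number of transitions. -/
def NFA0.size (M : NFA0 σ) : ℕ := M.trans.card

/-- One step of a run: a configuration is a state together with the input yet to be read;
an `ε`-transition leaves the input unchanged, a `some a`-transition consumes the letter `a`. -/
def NFA0.Step (M : NFA0 σ) : ℕ × List σ → ℕ × List σ → Prop := fun p q =>
  ((p.1, (none : Option σ), q.1) ∈ M.trans ∧ p.2 = q.2) ∨
    ∃ a, (p.1, some a, q.1) ∈ M.trans ∧ p.2 = a :: q.2

/-- The language recognized by an NFA: the words labelling accepting runs. -/
def NFA0.Lang (M : NFA0 σ) : Set (List σ) :=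
  {w | ∃ qf ∈ M.accept, Relation.ReflTransGen M.Step (M.start, w) (qf, [])}

end NFADefs

/-- The language `{ab : (a, b) ∈ E} ⊆ AB` of two-letter words associated with the edge set
`E` of a bipartite graph, over the (disjoint) union alphabet `α ⊕ β`. -/
def TwoLetterLang {α β : Type*} (E : Finset (α × β)) : Set (List (α ⊕ β)) :=
  {w | ∃ p ∈ E, w = [Sum.inl p.1, Sum.inr p.2]}

section ReachabilityToLanguage

variable {α β : Type*} {A : Finset α} {B : Finset β} {E : Finset (α × β)}

open Classical in
/-- The rectifier network whose edges are exactly those of the bipartite graph `(A, B, E)`. -/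
noncomputable def RectNet.ofEdges (hE : E ⊆ A ×ˢ B)
    (hA : ∀ a ∈ A, ∃ b, (a, b) ∈ E) (hB : ∀ b ∈ B, ∃ a, (a, b) ∈ E) : RectNet A B E :=
  let Ed : Finset (RVert α β × RVert α β) :=
    E.image fun p => (Sum.inl p.1, Sum.inr (Sum.inl p.2))
  have mem_Ed {x y : RVert α β} :
      (x, y) ∈ Ed ↔ ∃ a b, (a, b) ∈ E ∧ x = Sum.inl a ∧ y = Sum.inr (Sum.inl b) := by
    simp [Ed, eq_comm]
  have mem_AB {a : α} {b : β} (h : (a, b) ∈ E) : a ∈ A ∧ b ∈ B := mem_product.1 (hE h)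
  have of_transGen {x y : RVert α β} (h : Relation.TransGen (fun x y => (x, y) ∈ Ed) x y) :
      (x, y) ∈ Ed := by
    induction h with
    | single h => exact h
    | tail _ h ih =>
      obtain ⟨a, b, -, -, rfl⟩ := mem_Ed.1 ih
      obtain ⟨a', b', -, h, -⟩ := mem_Ed.1 h
      cases h
  { V := A.image Sum.inl ∪ B.image fun b => Sum.inr (Sum.inl b)
    Ed := Ed
    mem_fst := by
      rintro ⟨x, y⟩ hxy
      obtain ⟨a, b, h, rfl, rfl⟩ := mem_Ed.1 hxy
      simp [mem_AB h]
    mem_snd := by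
      rintro ⟨x, y⟩ hxy
      obtain ⟨a, b, h, rfl, rfl⟩ := mem_Ed.1 hxy
      simp [mem_AB h]
    acyclic := by
      intro v h
      obtain ⟨a, b, -, rfl, h⟩ := mem_Ed.1 (of_transGen h)
      cases h
    memA := by simp
    memB := by simp
    sources := by
      intro v hv
      simp only [mem_union, mem_image] at hv
      obtain ⟨a, ha, rfl⟩ | ⟨b, hb, rfl⟩ := hv
      · simp [mem_Ed, ha]
      · obtain ⟨a, h⟩ := hB b hb
        simpa [mem_Ed] using ⟨a, h⟩
    sinks := by
      intro v hv
      simp only [mem_union, mem_image] at hv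
      obtain ⟨a, ha, rfl⟩ | ⟨b, hb, rfl⟩ := hv
      · obtain ⟨b, h⟩ := hA a ha
        simpa [mem_Ed] using ⟨b, h⟩
      · simp [mem_Ed, hb]
    realizes := by
      intro a _ b _
      refine ⟨fun h => .single (mem_Ed.2 ⟨a, b, h, rfl, rfl⟩), fun h => ?_⟩
      obtain h | h := Relation.reflTransGen_iff_eq_or_transGen.1 h
      · cases h
      · obtain ⟨a', b', h, ⟨⟩, ⟨⟩⟩ := mem_Ed.1 (of_transGen h)
        exact h }

/-- If every letter is used, some rectifier network attains the minimum size `Rect A B E`. -/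
theorem exists_rectNet_size_eq_rect (hE : E ⊆ A ×ˢ B)
    (hA : ∀ a ∈ A, ∃ b, (a, b) ∈ E) (hB : ∀ b ∈ B, ∃ a, (a, b) ∈ E) :
    ∃ R : RectNet A B E, R.size = Rect A B E :=
  Nat.sInf_mem (s := {n | ∃ R : RectNet A B E, R.size = n})
    ⟨_, RectNet.ofEdges hE hA hB, rfl⟩

namespace RectNet

open Classical in
/-- The automaton obtained from a rectifier network by reading every edge as an `ε`-transition,
entering each source `a` from a new start state `0` by reading `a`, and leaving each sink `b` to
a new accepting state `1` by reading `b`. A vertex `v` becomes the state `f v + 2`. -/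
noncomputable def toNFA (R : RectNet A B E) (f : RVert α β → ℕ) : NFA0 (α ⊕ β) where
  states := {0, 1} ∪ R.V.image fun v => f v + 2
  start := 0
  accept := {1}
  trans := R.Ed.image (fun e => (f e.1 + 2, none, f e.2 + 2)) ∪
    A.image (fun a => (0, some (Sum.inl a), f (Sum.inl a) + 2)) ∪
    B.image (fun b => (f (Sum.inr (Sum.inl b)) + 2, some (Sum.inr b), 1))
  start_mem := by simp
  accept_sub := by simp
  trans_fst := by
    intro t ht
    simp only [mem_union, mem_image] at ht
    obtain (⟨e, he, rfl⟩ | ⟨a, ha, rfl⟩) | ⟨b, hb, rfl⟩ := ht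
    · exact mem_union_right _ (mem_image_of_mem _ (R.mem_fst e he))
    · simp
    · exact mem_union_right _ (mem_image_of_mem (fun v => f v + 2) (R.memB b hb))
  trans_snd := by
    intro t ht
    simp only [mem_union, mem_image] at ht
    obtain (⟨e, he, rfl⟩ | ⟨a, ha, rfl⟩) | ⟨b, hb, rfl⟩ := ht
    · exact mem_union_right _ (mem_image_of_mem _ (R.mem_snd e he))
    · exact mem_union_right _ (mem_image_of_mem (fun v => f v + 2) (R.memA a ha))
    · simp

variable (R : RectNet A B E) (f : RVert α β → ℕ)

theorem mem_toNFA_trans {t : ℕ × Option (α ⊕ β) × ℕ} :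
    t ∈ (R.toNFA f).trans ↔ (∃ e ∈ R.Ed, (f e.1 + 2, none, f e.2 + 2) = t) ∨
      (∃ a ∈ A, (0, some (Sum.inl a), f (Sum.inl a) + 2) = t) ∨
      ∃ b ∈ B, (f (Sum.inr (Sum.inl b)) + 2, some (Sum.inr b), 1) = t := by
  simp only [toNFA, mem_union, mem_image, or_assoc]

theorem toNFA_size_le : (R.toNFA f).size ≤ R.size + A.card + B.card := by
  classical
  refine (card_union_le _ _).trans (add_le_add ((card_union_le _ _).trans ?_) card_image_le)
  exact add_le_add card_image_le card_image_le

/-- The words accepted from each state of `R.toNFA f`. -/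
theorem accepted_of_reflTransGen_step (hf : Set.InjOn f R.V) {c : ℕ × List (α ⊕ β)}
    (h : Relation.ReflTransGen (R.toNFA f).Step c (1, [])) :
    c = (1, []) ∨
      (∃ v ∈ R.V, ∃ b ∈ B, c = (f v + 2, [Sum.inr b]) ∧
        Relation.ReflTransGen (fun x y => (x, y) ∈ R.Ed) v (Sum.inr (Sum.inl b))) ∨
      ∃ p ∈ E, c = (0, [Sum.inl p.1, Sum.inr p.2]) := by
  induction h using Relation.ReflTransGen.head_induction_on with
  | refl => exact .inl rfl
  | @head c d hcd _ ih =>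
    obtain ⟨q, w⟩ := c
    obtain ⟨q', w'⟩ := d
    simp only [NFA0.Step, mem_toNFA_trans, Prod.mk.injEq] at hcd
    simp only [Prod.mk.injEq] at ih
    obtain ⟨(⟨⟨x, y⟩, he, rfl, -, rfl⟩ | ⟨_, _, _, ⟨⟩, _⟩ | ⟨_, _, _, ⟨⟩, _⟩), rfl⟩ |
      ⟨l, (⟨_, _, _, ⟨⟩, _⟩ | ⟨a, ha, rfl, ⟨⟩, rfl⟩ | ⟨b, hb, rfl, ⟨⟩, rfl⟩), rfl⟩ := hcd
    · obtain ⟨h, -⟩ | ⟨v, hv, b, hb, ⟨h, rfl⟩, hr⟩ | ⟨_, _, h, _⟩ := ih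
      · omega
      · obtain rfl := hf (R.mem_snd _ he) hv (by simpa using h)
        exact .inr (.inl ⟨x, R.mem_fst _ he, b, hb, rfl, .head he hr⟩)
      · omega
    · obtain ⟨h, -⟩ | ⟨v, hv, b, hb, ⟨h, rfl⟩, hr⟩ | ⟨_, _, h, _⟩ := ih
      · omega
      · obtain rfl := hf (R.memA a ha) hv (by simpa using h)
        exact .inr (.inr ⟨(a, b), (R.realizes a ha b hb).2 hr, rfl⟩)
      · omega
    · obtain ⟨-, rfl⟩ | ⟨v, hv, b, hb, ⟨h, rfl⟩, hr⟩ | ⟨_, _, h, _⟩ := ih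
      · exact .inr (.inl ⟨_, R.memB b hb, b, hb, rfl, .refl⟩)
      · omega
      · omega

theorem reflTransGen_step_of_reflTransGen {x y : RVert α β}
    (h : Relation.ReflTransGen (fun x y => (x, y) ∈ R.Ed) x y) (w : List (α ⊕ β)) :
    Relation.ReflTransGen (R.toNFA f).Step (f x + 2, w) (f y + 2, w) := by
  induction h with
  | refl => exact .refl
  | tail _ he ih =>
    exact ih.tail (.inl ⟨(R.mem_toNFA_trans f).2 (.inl ⟨_, he, rfl⟩), rfl⟩)

theorem lang_toNFA (hE : E ⊆ A ×ˢ B) (hf : Set.InjOn f R.V) :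
    (R.toNFA f).Lang = TwoLetterLang E := by
  ext w
  constructor
  · rintro ⟨q, hq, h⟩
    obtain rfl : q = 1 := by simpa [toNFA] using hq
    obtain h | ⟨v, _, b, _, h, _⟩ | ⟨p, hp, h⟩ := R.accepted_of_reflTransGen_step f hf h
    · simp [toNFA] at h
    · simp [toNFA] at h
    · exact ⟨p, hp, congrArg Prod.snd h⟩
  · rintro ⟨⟨a, b⟩, hp, rfl⟩
    obtain ⟨ha, hb⟩ := mem_product.1 (hE hp)
    refine ⟨1, by simp [toNFA], ?_⟩
    refine .head (b := (f (Sum.inl a) + 2, [Sum.inr b]))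
      (.inr ⟨_, (R.mem_toNFA_trans f).2 (.inr (.inl ⟨a, ha, rfl⟩)), rfl⟩) ?_
    refine (R.reflTransGen_step_of_reflTransGen f ((R.realizes a ha b hb).1 hp) _).tail ?_
    exact .inr ⟨_, (R.mem_toNFA_trans f).2 (.inr (.inr ⟨b, hb, rfl⟩)), rfl⟩

end RectNet

end ReachabilityToLanguage

/-- for a language `L ⊆ AB` of two-letter words over disjoint alphabets `A`
and `B` in which every letter of `A` (resp. `B`) occurs as a first (resp. second) letter,
there is an NFA (with `ε`-transitions allowed) recognizing `L` of size at most
`Rect(G_L) + |A| + |B|`. -/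
theorem exists_nfa_of_rect {α β : Type*} (A : Finset α) (B : Finset β)
    (E : Finset (α × β)) (hE : E ⊆ A ×ˢ B)
    (hA : ∀ a ∈ A, ∃ b, (a, b) ∈ E) (hB : ∀ b ∈ B, ∃ a, (a, b) ∈ E) :
    ∃ M : NFA0 (α ⊕ β), M.Lang = TwoLetterLang E ∧
      M.size ≤ Rect A B E + A.card + B.card := by
  obtain ⟨R, hR⟩ := exists_rectNet_size_eq_rect hE hA hB
  obtain ⟨f, hf⟩ := Set.countable_iff_exists_injOn.1 R.V.countable_toSet
  exact ⟨R.toNFA f, R.lang_toNFA f hE hf, hR ▸ R.toNFA_size_le f⟩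
end

section
/- Let A and B be disjoint finite alphabets and let L ⊆ AB be a nonempty language of two-letter words such that every letter of A is the first letter of some word of L and every letter of B is the second letter of some word of L. Then for every ε-free NFA M recognizing L, Cov(G_L) ≤ |M|. -/
open Finset

/-- The state at which a transition of an automaton for two-letter words meets the middle of
the word: the target of a first-letter transition, the source of any other one. -/
def middleState {α β : Type*} (t : ℕ × Option (α ⊕ β) × ℕ) : ℕ :=
  match t with
  | (_, some (Sum.inl _), q) => q
  | (p, _, _) => p

theorem NFA0.EpsFree.step_iff {σ : Type*} {M : NFA0 σ} (hM : M.EpsFree) {p q : ℕ × List σ} :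
    M.Step p q ↔ ∃ a, (p.1, some a, q.1) ∈ M.trans ∧ p.2 = a :: q.2 := by
  refine ⟨?_, Or.inr⟩
  rintro (⟨h, -⟩ | h)
  · exact absurd rfl (hM _ h)
  · exact h

theorem NFA0.EpsFree.pair_mem_lang_iff {σ : Type*} {M : NFA0 σ} (hM : M.EpsFree) {x y : σ} :
    [x, y] ∈ M.Lang ↔ ∃ q, (M.start, some x, q) ∈ M.trans ∧
      ∃ f ∈ M.accept, (q, some y, f) ∈ M.trans := by
  constructor
  · rintro ⟨f, hf, hrun⟩
    rcases hrun.cases_head with h | ⟨⟨q, u⟩, h₁, hrun⟩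
    · simp at h
    obtain ⟨a, ha, hau⟩ := hM.step_iff.1 h₁
    obtain ⟨rfl, rfl⟩ : x = a ∧ [y] = u := by simpa using hau
    rcases hrun.cases_head with h | ⟨⟨r, v⟩, h₂, hrun⟩
    · simp at h
    obtain ⟨b, hb, hbv⟩ := hM.step_iff.1 h₂
    obtain ⟨rfl, rfl⟩ : y = b ∧ [] = v := by simpa using hbv
    rcases hrun.cases_head with h | ⟨⟨s, w⟩, h₃, -⟩
    · obtain rfl : r = f := by simpa using h
      exact ⟨q, ha, r, hf, hb⟩
    · obtain ⟨c, -, hc⟩ := hM.step_iff.1 h₃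
      simp at hc
  · rintro ⟨q, hx, f, hf, hy⟩
    exact ⟨f, hf, .head (b := (q, [y])) (hM.step_iff.2 ⟨x, hx, rfl⟩)
      (.single (hM.step_iff.2 ⟨y, hy, rfl⟩))⟩

theorem mem_twoLetterLang_iff {α β : Type*} {E : Finset (α × β)} {a : α} {b : β} :
    [Sum.inl a, Sum.inr b] ∈ TwoLetterLang E ↔ (a, b) ∈ E := by
  simp [TwoLetterLang]

/-- for a nonempty language `L ⊆ AB` of two-letter words over disjoint
alphabets `A` and `B` in which every letter of `A` (resp. `B`) occurs as a first
(resp. second) letter, every `ε`-free NFA `M` recognizing `L` satisfies `Cov(G_L) ≤ |M|`. -/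
theorem cov_le_epsfree_nfa_size {α β : Type*} (A : Finset α) (B : Finset β)
    (E : Finset (α × β)) (hE : E ⊆ A ×ˢ B) (hne : E.Nonempty)
    (hA : ∀ a ∈ A, ∃ b, (a, b) ∈ E) (hB : ∀ b ∈ B, ∃ a, (a, b) ∈ E) :
    ∀ M : NFA0 (α ⊕ β), M.EpsFree → M.Lang = TwoLetterLang E →
      Cov A B E ≤ M.size := by
  classical
  intro M hM hL
  have hmem (a : α) (b : β) : (a, b) ∈ E ↔ ∃ q, (M.start, some (Sum.inl a), q) ∈ M.trans ∧
      ∃ f ∈ M.accept, (q, some (Sum.inr b), f) ∈ M.trans := by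
    rw [← mem_twoLetterLang_iff, ← hL, hM.pair_mem_lang_iff]
  let P (q : ℕ) : Finset α := {a ∈ A | (M.start, some (Sum.inl a), q) ∈ M.trans}
  let S (q : ℕ) : Finset β := {b ∈ B | ∃ f ∈ M.accept, (q, some (Sum.inr b), f) ∈ M.trans}
  have hcover : IsBicliqueCover A B E (M.states.image fun q => (P q, S q)) := by
    constructor
    · intro p hp
      obtain ⟨q, -, rfl⟩ := mem_image.1 hp
      refine ⟨filter_subset _ _, filter_subset _ _, ?_⟩
      rintro ⟨a, b⟩ hab
      obtain ⟨ha, hb⟩ := mem_product.1 hab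
      exact (hmem a b).2 ⟨q, (mem_filter.1 ha).2, (mem_filter.1 hb).2⟩
    · rintro ⟨a, b⟩ hab
      obtain ⟨q, ha, hb⟩ := (hmem a b).1 hab
      obtain ⟨haA, hbB⟩ := mem_product.1 (hE hab)
      exact ⟨_, mem_image_of_mem _ (M.trans_snd _ ha), mem_filter.2 ⟨haA, ha⟩,
        mem_filter.2 ⟨hbB, hb⟩⟩
  have hweight (q : ℕ) : #(P q) + #(S q) ≤ #{t ∈ M.trans | middleState t = q} := by
    rw [← card_disjSum, ← card_map Function.Embedding.some]
    refine (card_le_card ?_).trans (card_image_le (f := fun t => t.2.1))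
    intro l hl
    obtain ⟨x, hx, rfl⟩ := mem_map.1 hl
    rcases x with a | b
    · exact mem_image.2 ⟨_, mem_filter.2 ⟨(mem_filter.1 (inl_mem_disjSum.1 hx)).2, rfl⟩, rfl⟩
    · obtain ⟨f, -, hf⟩ := (mem_filter.1 (inr_mem_disjSum.1 hx)).2
      exact mem_image.2 ⟨_, mem_filter.2 ⟨hf, rfl⟩, rfl⟩
  have hmiddle : ∀ t ∈ M.trans, middleState t ∈ M.states := by
    rintro ⟨p, l, q⟩ ht
    unfold middleState
    split
    · rename_i heq
      cases heq
      exact M.trans_snd _ ht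
    · rename_i heq
      cases heq
      exact M.trans_fst _ ht
  calc Cov A B E
      ≤ ∑ p ∈ M.states.image fun q => (P q, S q), (#p.1 + #p.2) := Nat.sInf_le ⟨_, hcover, rfl⟩
    _ ≤ ∑ q ∈ M.states, (#(P q) + #(S q)) :=
        sum_image_le_of_nonneg fun _ _ => Nat.zero_le _
    _ ≤ ∑ q ∈ M.states, #{t ∈ M.trans | middleState t = q} := sum_le_sum fun q _ => hweight q
    _ = M.size := (card_eq_sum_card_fiberwise hmiddle).symm
end

section
/- There exist constants C > 0 and k ≥ 0 such that for every positive integer n ≥ 2, the minimum size of a rectifier network realizing G_Δ^n satisfies Rect(G_Δ^n) ≤ C·n·(log n)^k. -/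
open Finset

/-- The edge set of the graph `G_Δ^n`: both vertex classes are `{1, …, n}` and `(i, j)` is
an edge iff the circular distance `min(|i − j|, n − |i − j|)` is at most `n/4`. -/
def deltaEdges (n : ℕ) : Finset (ℕ × ℕ) :=
  (Finset.Icc 1 n ×ˢ Finset.Icc 1 n).filter
    (fun p => min (Nat.dist p.1 p.2) (n - Nat.dist p.1 p.2) ≤ n / 4)

section HubNetworks

variable {α β : Type*}

/-- A depth-two network with hubs indexed by `ℕ`, given by its source-to-hub edges `U` and its
hub-to-sink edges `W`, bounds `Rect`. -/
theorem Rect_le_of_hubs [DecidableEq α] [DecidableEq β] {A : Finset α} {B : Finset β}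
    {E : Finset (α × β)} (U : Finset (α × ℕ)) (W : Finset (ℕ × β))
    (hUA : ∀ p ∈ U, p.1 ∈ A) (hWB : ∀ p ∈ W, p.2 ∈ B)
    (hUW : ∀ x, (∃ a, (a, x) ∈ U) ↔ ∃ b, (x, b) ∈ W)
    (hA : ∀ a ∈ A, ∃ x, (a, x) ∈ U) (hB : ∀ b ∈ B, ∃ x, (x, b) ∈ W)
    (hE : ∀ a ∈ A, ∀ b ∈ B, ((a, b) ∈ E ↔ ∃ x, (a, x) ∈ U ∧ (x, b) ∈ W)) :
    Rect A B E ≤ U.card + W.card := by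
  set Ed : Finset (RVert α β × RVert α β) :=
    U.image (fun p => (Sum.inl p.1, Sum.inr (Sum.inr p.2))) ∪
      W.image (fun p => (Sum.inr (Sum.inr p.1), Sum.inr (Sum.inl p.2))) with hEd
  set V : Finset (RVert α β) :=
    A.image Sum.inl ∪ B.image (fun b => Sum.inr (Sum.inl b)) ∪
      U.image (fun p => Sum.inr (Sum.inr p.2)) with hV
  have mem_Ed (u v : RVert α β) : (u, v) ∈ Ed ↔
      (∃ a x, (a, x) ∈ U ∧ u = Sum.inl a ∧ v = Sum.inr (Sum.inr x)) ∨
      ∃ x b, (x, b) ∈ W ∧ u = Sum.inr (Sum.inr x) ∧ v = Sum.inr (Sum.inl b) := by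
    simp only [hEd, mem_union, mem_image, Prod.mk.injEq, Prod.exists, eq_comm]
  have mem_V (v : RVert α β) : v ∈ V ↔ (∃ a ∈ A, v = Sum.inl a) ∨
      (∃ b ∈ B, v = Sum.inr (Sum.inl b)) ∨ ∃ a x, (a, x) ∈ U ∧ v = Sum.inr (Sum.inr x) := by
    simp only [hV, mem_union, mem_image, Prod.exists, eq_comm, or_assoc]
  let R : RectNet A B E :=
    { V := V
      Ed := Ed
      mem_fst := by
        rintro ⟨u, v⟩ h
        rw [mem_V]
        obtain ⟨a, x, hax, rfl, rfl⟩ | ⟨x, b, hxb, rfl, rfl⟩ := (mem_Ed _ _).1 h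
        · exact .inl ⟨a, hUA _ hax, rfl⟩
        · obtain ⟨a, ha⟩ := (hUW x).2 ⟨b, hxb⟩
          exact .inr (.inr ⟨a, x, ha, rfl⟩)
      mem_snd := by
        rintro ⟨u, v⟩ h
        rw [mem_V]
        obtain ⟨a, x, hax, rfl, rfl⟩ | ⟨x, b, hxb, rfl, rfl⟩ := (mem_Ed _ _).1 h
        · exact .inr (.inr ⟨a, x, hax, rfl⟩)
        · exact .inr (.inl ⟨b, hWB _ hxb, rfl⟩)
      acyclic := by
        intro v hv
        let rank : RVert α β → ℕ := Sum.elim (fun _ => 0) (Sum.elim (fun _ => 2) (fun _ => 1))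
        have hlt {u w} (h : Relation.TransGen (fun x y => (x, y) ∈ Ed) u w) : rank u < rank w := by
          have step {u w} (h : (u, w) ∈ Ed) : rank u < rank w := by
            obtain ⟨a, x, -, rfl, rfl⟩ | ⟨x, b, -, rfl, rfl⟩ := (mem_Ed _ _).1 h <;> simp [rank]
          induction h with
          | single h => exact step h
          | tail _ h ih => exact ih.trans (step h)
        exact lt_irrefl _ (hlt hv)
      memA := fun a ha => (mem_V _).2 (.inl ⟨a, ha, rfl⟩)
      memB := fun b hb => (mem_V _).2 (.inr (.inl ⟨b, hb, rfl⟩))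
      sources := by
        intro v hv
        constructor
        · intro h
          obtain ha | ⟨b, hb, rfl⟩ | ⟨a, x, hax, rfl⟩ := (mem_V v).1 hv
          · exact ha
          · obtain ⟨x, hx⟩ := hB b hb
            exact (h _ ((mem_Ed _ _).2 (.inr ⟨x, b, hx, rfl, rfl⟩))).elim
          · exact (h _ ((mem_Ed _ _).2 (.inl ⟨a, x, hax, rfl, rfl⟩))).elim
        · rintro ⟨a, -, rfl⟩ u hu
          simp [mem_Ed] at hu
      sinks := by
        intro v hv
        constructor
        · intro h
          obtain ⟨a, ha, rfl⟩ | hb | ⟨a, x, hax, rfl⟩ := (mem_V v).1 hv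
          · obtain ⟨x, hx⟩ := hA a ha
            exact (h _ ((mem_Ed _ _).2 (.inl ⟨a, x, hx, rfl, rfl⟩))).elim
          · exact hb
          · obtain ⟨b, hb⟩ := (hUW x).1 ⟨a, hax⟩
            exact (h _ ((mem_Ed _ _).2 (.inr ⟨x, b, hb, rfl, rfl⟩))).elim
        · rintro ⟨b, -, rfl⟩ u hu
          simp [mem_Ed] at hu
      realizes := by
        intro a ha b hb
        rw [hE a ha b hb]
        constructor
        · rintro ⟨x, hax, hxb⟩
          exact .head ((mem_Ed _ _).2 (.inl ⟨a, x, hax, rfl, rfl⟩))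
            (.single ((mem_Ed _ _).2 (.inr ⟨x, b, hxb, rfl, rfl⟩)))
        · intro h
          obtain h | ⟨u, hu, h⟩ := h.cases_head
          · cases h
          obtain ⟨a', x, hax, h₁, rfl⟩ | ⟨x, b', -, h₁, -⟩ := (mem_Ed _ _).1 hu
          swap
          · cases h₁
          cases h₁
          obtain h | ⟨w, hw, h⟩ := h.cases_head
          · cases h
          obtain ⟨_, _, -, h₁, -⟩ | ⟨x', b', hxb, h₁, rfl⟩ := (mem_Ed _ _).1 hw
          · cases h₁
          cases h₁
          obtain h | ⟨z, hz, -⟩ := h.cases_head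
          · cases h
            exact ⟨x, hax, hxb⟩
          · simp [mem_Ed] at hz }
  calc Rect A B E ≤ R.size := Nat.sInf_le ⟨R, rfl⟩
    _ ≤ U.card + W.card :=
      (card_union_le _ _).trans (Nat.add_le_add card_image_le card_image_le)

/-- `a` and `b` receive a common label from some pair of partial labellings in `l`. -/
def SharesLabel (l : List ((α → Option ℕ) × (β → Option ℕ))) (a : α) (b : β) : Prop :=
  ∃ p ∈ l, ∃ h, p.1 a = some h ∧ p.2 b = some h

theorem sharesLabel_append (l₁ l₂ : List ((α → Option ℕ) × (β → Option ℕ))) (a : α) (b : β) :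
    SharesLabel (l₁ ++ l₂) a b ↔ SharesLabel l₁ a b ∨ SharesLabel l₂ a b := by
  simp only [SharesLabel, List.mem_append, or_and_right, exists_or]

theorem sharesLabel_swap (l : List ((α → Option ℕ) × (β → Option ℕ))) (a : α) (b : β) :
    SharesLabel (l.map Prod.swap) b a ↔ SharesLabel l a b := by
  simp only [SharesLabel, List.mem_map, exists_exists_and_eq_and, Prod.fst_swap, Prod.snd_swap]
  simp only [and_comm]

/-- Pull labellings back along `u` and `v`, refining the labels by `c` and `d`. -/
def refineLabels {γ δ : Type*} (u : γ → α) (v : δ → β) (c : γ → ℕ) (d : δ → ℕ)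
    (l : List ((α → Option ℕ) × (β → Option ℕ))) : List ((γ → Option ℕ) × (δ → Option ℕ)) :=
  l.map fun p => (fun i => (p.1 (u i)).map (Nat.pair (c i)),
    fun j => (p.2 (v j)).map (Nat.pair (d j)))

theorem sharesLabel_refineLabels {γ δ : Type*} (u : γ → α) (v : δ → β) (c : γ → ℕ) (d : δ → ℕ)
    (l : List ((α → Option ℕ) × (β → Option ℕ))) (i : γ) (j : δ) :
    SharesLabel (refineLabels u v c d l) i j ↔ c i = d j ∧ SharesLabel l (u i) (v j) := by
  have mem_map (p : (α → Option ℕ) × (β → Option ℕ)) :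
      (∃ h, (p.1 (u i)).map (Nat.pair (c i)) = some h ∧ (p.2 (v j)).map (Nat.pair (d j)) = some h) ↔
        c i = d j ∧ ∃ h, p.1 (u i) = some h ∧ p.2 (v j) = some h := by
    simp only [Option.map_eq_some_iff]
    constructor
    · rintro ⟨_, ⟨h, hi, rfl⟩, h', hj, e⟩
      obtain ⟨e₁, rfl⟩ := Nat.pair_eq_pair.1 e
      exact ⟨e₁.symm, h', hi, hj⟩
    · rintro ⟨e, h, hi, hj⟩
      exact ⟨_, ⟨h, hi, rfl⟩, h, hj, by rw [e]⟩
  simp only [SharesLabel, refineLabels, List.mem_map, exists_exists_and_eq_and, mem_map]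
  constructor
  · rintro ⟨p, hp, e, h⟩
    exact ⟨e, p, hp, h⟩
  · rintro ⟨e, p, hp, h⟩
    exact ⟨p, hp, e, h⟩

/-- Every labelling contributes at most one edge per vertex. -/
theorem Rect_le_of_labels [DecidableEq α] [DecidableEq β] {A : Finset α} {B : Finset β}
    {E : Finset (α × β)} (l : List ((α → Option ℕ) × (β → Option ℕ)))
    (hA : ∀ a ∈ A, ∃ b ∈ B, (a, b) ∈ E) (hB : ∀ b ∈ B, ∃ a ∈ A, (a, b) ∈ E)
    (hE : ∀ a ∈ A, ∀ b ∈ B, ((a, b) ∈ E ↔ SharesLabel l a b)) :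
    Rect A B E ≤ l.length * (A.card + B.card) := by
  classical
  set P : ℕ → α → β → Prop := fun x a b => ∃ t : Fin l.length, ∃ h, x = Nat.pair t h ∧
    l[t].1 a = some h ∧ l[t].2 b = some h with hP
  set U : Finset (α × ℕ) := ((A ×ˢ (univ : Finset (Fin l.length))).image
    (fun p => (p.1, Nat.pair p.2 ((l[p.2].1 p.1).getD 0)))).filter
      (fun p => ∃ b ∈ B, P p.2 p.1 b) with hU
  set W : Finset (ℕ × β) := ((B ×ˢ (univ : Finset (Fin l.length))).image
    (fun p => (Nat.pair p.2 ((l[p.2].2 p.1).getD 0), p.1))).filter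
      (fun p => ∃ a ∈ A, P p.1 a p.2) with hW
  have mem_U (a : α) (x : ℕ) : (a, x) ∈ U ↔ a ∈ A ∧ ∃ b ∈ B, P x a b := by
    simp only [hU, mem_filter, mem_image, mem_product, mem_univ, and_true, Prod.exists,
      Prod.mk.injEq]
    constructor
    · rintro ⟨⟨a', t, ha, rfl, -⟩, h⟩
      exact ⟨ha, h⟩
    · rintro ⟨ha, b, hb, hx⟩
      refine ⟨?_, b, hb, hx⟩
      obtain ⟨t, h, rfl, h₁, -⟩ := hx
      exact ⟨a, t, ha, rfl, by rw [h₁, Option.getD_some]⟩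
  have mem_W (b : β) (x : ℕ) : (x, b) ∈ W ↔ b ∈ B ∧ ∃ a ∈ A, P x a b := by
    simp only [hW, mem_filter, mem_image, mem_product, mem_univ, and_true, Prod.exists,
      Prod.mk.injEq]
    constructor
    · rintro ⟨⟨b', t, hb, -, rfl⟩, h⟩
      exact ⟨hb, h⟩
    · rintro ⟨hb, a, ha, hx⟩
      refine ⟨?_, a, ha, hx⟩
      obtain ⟨t, h, rfl, -, h₁⟩ := hx
      exact ⟨b, t, hb, by rw [h₁, Option.getD_some], rfl⟩
  have shares_iff (a : α) (b : β) : SharesLabel l a b ↔ ∃ x, P x a b := by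
    constructor
    · rintro ⟨p, hp, h, h₁, h₂⟩
      obtain ⟨t, ht, rfl⟩ := List.mem_iff_getElem.1 hp
      exact ⟨_, ⟨t, ht⟩, h, rfl, h₁, h₂⟩
    · rintro ⟨_, t, h, -, h₁, h₂⟩
      exact ⟨l[t], List.getElem_mem t.2, h, h₁, h₂⟩
  have P_trans {x : ℕ} {a a' : α} {b b' : β} (h : P x a b') (h' : P x a' b) : P x a b := by
    obtain ⟨t, h, rfl, h₁, -⟩ := h
    obtain ⟨t', h', e, -, h₂⟩ := h'
    obtain ⟨e₁, rfl⟩ := Nat.pair_eq_pair.1 e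
    obtain rfl := Fin.ext e₁
    exact ⟨t, h, rfl, h₁, h₂⟩
  have key : Rect A B E ≤ U.card + W.card := by
    refine Rect_le_of_hubs U W (fun p hp => ((mem_U p.1 p.2).1 hp).1)
      (fun p hp => ((mem_W p.2 p.1).1 hp).1) (fun x => ?_) (fun a ha => ?_) (fun b hb => ?_)
      (fun a ha b hb => ?_)
    · simp only [mem_U, mem_W]
      constructor
      · rintro ⟨a, ha, b, hb, h⟩
        exact ⟨b, hb, a, ha, h⟩
      · rintro ⟨b, hb, a, ha, h⟩
        exact ⟨a, ha, b, hb, h⟩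
    · obtain ⟨b, hb, h⟩ := hA a ha
      obtain ⟨x, hx⟩ := (shares_iff a b).1 ((hE a ha b hb).1 h)
      exact ⟨x, (mem_U a x).2 ⟨ha, b, hb, hx⟩⟩
    · obtain ⟨a, ha, h⟩ := hB b hb
      obtain ⟨x, hx⟩ := (shares_iff a b).1 ((hE a ha b hb).1 h)
      exact ⟨x, (mem_W b x).2 ⟨hb, a, ha, hx⟩⟩
    · rw [hE a ha b hb, shares_iff]
      simp only [mem_U, mem_W]
      constructor
      · rintro ⟨x, hx⟩
        exact ⟨x, ⟨ha, b, hb, hx⟩, hb, a, ha, hx⟩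
      · rintro ⟨x, ⟨-, b', -, h⟩, -, a', -, h'⟩
        exact ⟨x, P_trans h h'⟩
  have hUc : U.card ≤ A.card * l.length :=
    ((card_filter_le _ _).trans card_image_le).trans (by simp)
  have hWc : W.card ≤ B.card * l.length :=
    ((card_filter_le _ _).trans card_image_le).trans (by simp)
  linarith

end HubNetworks

/-- The strict order on `{0, …, 2 ^ L - 1}` is described by `L` labellings. -/
theorem exists_labels_lt (L : ℕ) :
    ∃ l : List ((ℕ → Option ℕ) × (ℕ → Option ℕ)), l.length = L ∧
      ∀ i j, i < 2 ^ L → j < 2 ^ L → (SharesLabel l i j ↔ i < j) := by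
  induction L with
  | zero =>
    refine ⟨[], rfl, fun i j hi hj => ?_⟩
    simp only [SharesLabel, List.not_mem_nil, false_and, exists_false, false_iff]
    omega
  | succ L ih =>
    obtain ⟨l, hl, h⟩ := ih
    refine ⟨refineLabels (· / 2) (· / 2) (fun _ => 0) (fun _ => 0) l ++
      [(fun i => if i % 2 = 0 then some (i / 2) else none,
        fun j => if j % 2 = 1 then some (j / 2) else none)], by simp [refineLabels, hl],
      fun i j hi hj => ?_⟩
    rw [pow_succ] at hi hj
    rw [sharesLabel_append, sharesLabel_refineLabels, h _ _ (by omega) (by omega)]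
    simp only [SharesLabel, List.mem_singleton, exists_eq_left, Option.ite_none_right_eq_some,
      Option.some.injEq, true_and]
    constructor
    · rintro (h | ⟨_, ⟨h₁, rfl⟩, h₂, h₃⟩) <;> omega
    · intro h
      by_cases h' : i / 2 < j / 2
      · exact .inl h'
      · exact .inr ⟨i / 2, ⟨by omega, rfl⟩, by omega, by omega⟩

theorem mem_Icc_add_iff_div_mod (m i j : ℕ) : (i ≤ j ∧ j ≤ i + m) ↔
    (i / (m + 1) = j / (m + 1) ∧ i % (m + 1) < j % (m + 1) + 1) ∨
      (j / (m + 1) = i / (m + 1) + 1 ∧ j % (m + 1) < i % (m + 1)) := by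
  have hi := Nat.div_add_mod i (m + 1)
  have hj := Nat.div_add_mod j (m + 1)
  have hi' := Nat.mod_lt i (Nat.succ_pos m)
  have hj' := Nat.mod_lt j (Nat.succ_pos m)
  generalize i / (m + 1) = a at *
  generalize j / (m + 1) = b at *
  generalize i % (m + 1) = r at *
  generalize j % (m + 1) = s at *
  subst hi hj
  constructor
  · rintro ⟨h₁, h₂⟩
    have hab : a < b + 1 := by
      by_contra! h
      nlinarith [Nat.mul_le_mul_left (m + 1) h]
    have hba : b < a + 2 := by
      by_contra! h
      nlinarith [Nat.mul_le_mul_left (m + 1) h]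
    obtain rfl | rfl : b = a ∨ b = a + 1 := by omega
    · exact .inl ⟨rfl, by omega⟩
    · exact .inr ⟨rfl, by rw [mul_add] at h₂; omega⟩
  · rintro (⟨rfl, h⟩ | ⟨rfl, h⟩)
    · omega
    · rw [mul_add]
      omega

theorem exists_labels_deltaEdges {n L : ℕ} (hL : n + 1 < 2 ^ L) :
    ∃ l : List ((ℕ → Option ℕ) × (ℕ → Option ℕ)), l.length = 6 * L ∧
      ∀ i ∈ Icc 1 n, ∀ j ∈ Icc 1 n, ((i, j) ∈ deltaEdges n ↔ SharesLabel l i j) := by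
  obtain ⟨l, hl, h⟩ := exists_labels_lt L
  obtain ⟨m, hm⟩ : ∃ m, m = n / 4 := ⟨_, rfl⟩
  let l₁ := refineLabels (· % (m + 1)) (· % (m + 1) + 1) (· / (m + 1)) (· / (m + 1)) l
  let l₂ := (refineLabels (· % (m + 1)) (· % (m + 1)) (· / (m + 1)) (· / (m + 1) + 1) l).map
    Prod.swap
  let l₃ := refineLabels id (fun j => j + 1 - (n - m)) (fun _ => 0) (fun _ => 0) l
  have key : ∀ i ∈ Icc 1 n, ∀ j ∈ Icc 1 n, (SharesLabel (l₁ ++ l₂ ++ l₃) i j ↔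
      (i ≤ j ∧ j ≤ i + m) ∨ i + (n - m) ≤ j) := by
    intro i hi j hj
    rw [mem_Icc] at hi hj
    have hi' := Nat.mod_le i (m + 1)
    have hj' := Nat.mod_le j (m + 1)
    rw [mem_Icc_add_iff_div_mod, sharesLabel_append, sharesLabel_append,
      sharesLabel_refineLabels, sharesLabel_swap, sharesLabel_refineLabels,
      sharesLabel_refineLabels, h _ _ (by omega) (by omega), h _ _ (by omega) (by omega),
      h _ _ (by rw [id]; omega) (by omega)]
    refine or_congr Iff.rfl ?_
    rw [id]
    omega
  refine ⟨(l₁ ++ l₂ ++ l₃) ++ (l₁ ++ l₂ ++ l₃).map Prod.swap, ?_, fun i hi j hj => ?_⟩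
  · simp only [l₁, l₂, l₃, refineLabels, List.length_append, List.length_map, hl]
    ring
  · rw [sharesLabel_append, sharesLabel_swap, key i hi j hj, key j hj i hi]
    rw [deltaEdges, mem_filter, mem_product, ← hm]
    simp only [hi, hj, and_self, true_and, Nat.dist]
    rw [mem_Icc] at hi hj
    omega

theorem Rect_deltaEdges_le {n L : ℕ} (hL : n + 1 < 2 ^ L) :
    Rect (Icc 1 n) (Icc 1 n) (deltaEdges n) ≤ 6 * L * (n + n) := by
  obtain ⟨l, hl, h⟩ := exists_labels_deltaEdges hL
  have hdiag : ∀ i ∈ Icc 1 n, (i, i) ∈ deltaEdges n := fun i hi => by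
    simp only [deltaEdges, mem_filter, mem_product, hi, Nat.dist_self, Nat.zero_min, Nat.zero_le,
      and_self]
  simpa [hl] using Rect_le_of_labels l (fun i hi => ⟨i, hi, hdiag i hi⟩)
    (fun i hi => ⟨i, hi, hdiag i hi⟩) h

/-- there are constants `C > 0` and `k ≥ 0` such that for all `n ≥ 2`,
`Rect(G_Δ^n) ≤ C · n · (log n)^k`. -/
theorem rect_deltaGraph :
    ∃ C : ℝ, 0 < C ∧ ∃ k : ℕ, ∀ n : ℕ, 2 ≤ n →
      (Rect (Finset.Icc 1 n) (Finset.Icc 1 n) (deltaEdges n) : ℝ) ≤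
        C * n * Real.log n ^ k := by
  refine ⟨72, by norm_num, 1, fun n hn => ?_⟩
  have hL : n + 1 < 2 ^ (Nat.log 2 n + 2) := by
    have := Nat.lt_pow_succ_log_self one_lt_two n
    rw [pow_succ]
    omega
  have hn' : (2 : ℝ) ≤ n := by exact_mod_cast hn
  have hlog2 : (1 / 2 : ℝ) < Real.log 2 := by linarith [Real.log_two_gt_d9]
  have hlogn : Real.log 2 ≤ Real.log n := Real.log_le_log two_pos hn'
  have hlog : (Nat.log 2 n : ℝ) * Real.log 2 ≤ Real.log n := by
    rw [← Real.log_pow]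
    exact Real.log_le_log (by positivity) (by exact_mod_cast Nat.pow_log_le_self 2 (by omega))
  have hlog' : (Nat.log 2 n : ℝ) ≤ 2 * Real.log n := by
    nlinarith [(Nat.log 2 n).cast_nonneg (α := ℝ)]
  calc (Rect (Icc 1 n) (Icc 1 n) (deltaEdges n) : ℝ)
      ≤ 6 * (Nat.log 2 n + 2) * (n + n) := by exact_mod_cast Rect_deltaEdges_le hL
    _ = 12 * n * (Nat.log 2 n + 2) := by ring
    _ ≤ 12 * n * (6 * Real.log n) := by gcongr; linarith
    _ = 72 * n * Real.log n ^ 1 := by ring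
end
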